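/- arXiv:math/0610671 — 9 statements merged into one kernel-verified Lean document; each statement's English description precedes it below -/
import Mathlib

section
/- Let V be a 10-dimensional vector space over the field F2 = ZMod 2 and Q a quadratic form on V whose polar bilinear form is nondegenerate, and suppose Q is of plus type. Then for any two totally singular subspaces W1 and W2 of V with the same dimension, there exists a linear automorphism g of V satisfying Q ∘ g = Q and g(W1) = W2 (i.e., the orthogonal group O(V,Q) acts transitively on the set of i-dimensional totally singular subspaces for every i). -/
open Module QuadraticMap in
/-- Vectors of a totally singular subspace are pairwise orthogonal. -/
theorem QuadraticForm.polar_eq_zero_of_totally_singular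
    {K V : Type*} [Field K] [AddCommGroup V] [Module K V] {Q : QuadraticForm K V}
    {W : Submodule K V} (hW : ∀ w ∈ W, Q w = 0) {x y : V} (hx : x ∈ W) (hy : y ∈ W) :
    polar Q x y = 0 := by
  simp [polar, hW _ (W.add_mem hx hy), hW _ hx, hW _ hy]

open Module QuadraticMap in
/-- If a nondegenerate quadratic space has a totally singular subspace of half the dimension, then
every totally singular subspace is contained in one. -/
theorem QuadraticForm.exists_totally_singular_ge_of_finrank
    {K V : Type*} [Field K] [AddCommGroup V] [Module K V] [FiniteDimensional K V]
    {Q : QuadraticForm K V} (hQ : Q.polarBilin.Nondegenerate)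
    {U : Submodule K V} (hU : ∀ u ∈ U, Q u = 0) (hUV : 2 * finrank K U = finrank K V)
    {W : Submodule K V} (hW : ∀ w ∈ W, Q w = 0) :
    ∃ X : Submodule K V, W ≤ X ∧ (∀ x ∈ X, Q x = 0) ∧ finrank K X = finrank K U := by
  have hUorth : LinearMap.BilinForm.orthogonal Q.polarBilin U = U := by
    refine (Submodule.eq_of_le_of_finrank_eq (fun x hx y hy ↦ ?_) ?_).symm
    · exact polar_eq_zero_of_totally_singular hU hy hx
    · rw [LinearMap.BilinForm.finrank_orthogonal hQ]
      omega
  let P := U ⊓ LinearMap.BilinForm.orthogonal Q.polarBilin W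
  have hPorth : P = LinearMap.BilinForm.orthogonal Q.polarBilin (U ⊔ W) := by
    ext x
    constructor
    · rintro ⟨hxU, hxW⟩ y hy
      obtain ⟨u, hu, w, hw, rfl⟩ := Submodule.mem_sup.mp hy
      have h₁ : polar Q u x = 0 := polar_eq_zero_of_totally_singular hU hu hxU
      have h₂ : polar Q w x = 0 := hxW w hw
      simp [h₁, h₂]
    · intro hx
      refine ⟨?_, fun w hw ↦ hx w (Submodule.mem_sup_right hw)⟩
      rw [← hUorth]
      exact fun u hu ↦ hx u (Submodule.mem_sup_left hu)
  have hPW : P ⊓ W = U ⊓ W := by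
    ext x
    refine ⟨fun h ↦ ⟨h.1.1, h.2⟩, fun h ↦ ⟨⟨h.1, fun w hw ↦ ?_⟩, h.2⟩⟩
    exact polar_eq_zero_of_totally_singular hW hw h.2
  refine ⟨P ⊔ W, le_sup_right, fun x hx ↦ ?_, ?_⟩
  · obtain ⟨u, ⟨huU, huW⟩, w, hw, rfl⟩ := Submodule.mem_sup.mp hx
    have h : polar Q u w = 0 := (polar_comm Q u w).trans (huW w hw)
    rw [QuadraticMap.map_add Q, hU u huU, hW w hw, h]
    simp
  · have h₁ := Submodule.finrank_sup_add_finrank_inf_eq P W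
    have h₂ := Submodule.finrank_sup_add_finrank_inf_eq U W
    have h₃ := LinearMap.BilinForm.finrank_orthogonal hQ (U ⊔ W)
    have h₄ := Submodule.finrank_le (U ⊔ W)
    rw [← hPorth] at h₃
    rw [hPW] at h₁
    omega

open Module QuadraticMap in
/-- A nondegenerate quadratic space with a totally singular subspace `U` of half the dimension is
the hyperbolic space on `U`, by an isometry that restricts to the inclusion of `U`. -/
theorem QuadraticForm.exists_dualProd_isometryEquiv_of_finrank
    {K V : Type*} [Field K] [AddCommGroup V] [Module K V] [FiniteDimensional K V]
    {Q : QuadraticForm K V} (hQ : Q.polarBilin.Nondegenerate)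
    {U : Submodule K V} (hU : ∀ u ∈ U, Q u = 0) (hUV : 2 * finrank K U = finrank K V) :
    ∃ Φ : (QuadraticForm.dualProd K U).IsometryEquiv Q, ∀ u : U, Φ (0, u) = u := by
  obtain ⟨r, hr⟩ := U.dualRestrict.exists_rightInverse_of_surjective
    (LinearMap.range_eq_top.mpr Subspace.dualRestrict_surjective)
  let s : Dual K U →ₗ[K] V :=
    (LinearMap.BilinForm.toDual Q.polarBilin hQ).symm.toLinearMap ∘ₗ r
  have hs (φ : Dual K U) (u : U) : polar Q (s φ) u = φ u := by
    have h₁ : LinearMap.BilinForm.toDual Q.polarBilin hQ (s φ) = r φ := by simp [s]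
    have h₂ : LinearMap.BilinForm.toDual Q.polarBilin hQ (s φ) u = polar Q (s φ) u := rfl
    rw [← h₂, h₁]
    exact LinearMap.congr_fun (LinearMap.congr_fun hr φ) u
  obtain ⟨β, hβ⟩ := LinearMap.BilinMap.toQuadraticMap_surjective (Q.comp s)
  let c : Dual K U →ₗ[K] U := (evalEquiv K U).symm.toLinearMap ∘ₗ β
  have hc (φ ψ : Dual K U) : ψ (c φ) = β φ ψ := by
    simp [c]
  have hβs (φ : Dual K U) : β φ φ = Q (s φ) := DFunLike.congr_fun hβ φ
  let t : Dual K U →ₗ[K] V := s - U.subtype ∘ₗ c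
  have ht (φ : Dual K U) (u : U) : polar Q (t φ) u = φ u := by
    have h : polar Q (c φ : V) u = 0 :=
      polar_eq_zero_of_totally_singular hU (c φ).2 u.2
    simp [t, polar_sub_left, hs, h]
  have hQt (φ : Dual K U) : Q (t φ) = 0 := by
    have h : Q (s φ) = Q (t φ + (c φ : V)) := by simp [t]
    rw [QuadraticMap.map_add Q, ht, hc, hβs, hU _ (c φ).2] at h
    simpa using h
  let f : Dual K U × U →ₗ[K] V := t.coprod U.subtype
  have hf (p : Dual K U × U) : Q (f p) = p.1 p.2 := by
    simp [f, QuadraticMap.map_add Q, hQt, ht, hU _ p.2.2]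
  have hinj : Function.Injective f := by
    rw [← LinearMap.ker_eq_bot, LinearMap.ker_eq_bot']
    rintro ⟨φ, u⟩ h
    replace h : t φ + (u : V) = 0 := h
    have hφ : φ = 0 := by
      ext v
      have h₁ : polar Q (u : V) v = 0 :=
        polar_eq_zero_of_totally_singular hU u.2 v.2
      have h₂ : polar Q (t φ + (u : V)) v = 0 := by simp [h]
      simpa [polar_add_left, ht, h₁] using h₂
    subst hφ
    simpa using h
  have hfin : finrank K (Dual K U × U) = finrank K V := by
    rw [finrank_prod, Subspace.dual_finrank_eq]
    omega
  refine ⟨⟨LinearEquiv.ofInjectiveOfFinrankEq f hinj hfin, fun p ↦ hf p⟩, fun u ↦ ?_⟩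
  change f (0, u) = u
  simp [f]

open Module in
/-- Linear isomorphisms between spaces of equal finite dimension act transitively on pairs of
subspaces of equal dimension. -/
theorem Submodule.exists_linearEquiv_map_eq_of_finrank_eq
    {K V V' : Type*} [Field K] [AddCommGroup V] [Module K V] [FiniteDimensional K V]
    [AddCommGroup V'] [Module K V'] [FiniteDimensional K V']
    (hV : finrank K V = finrank K V') (W : Submodule K V) (W' : Submodule K V')
    (hW : finrank K W = finrank K W') :
    ∃ e : V ≃ₗ[K] V', W.map (e : V →ₗ[K] V') = W' := by
  let e₀ : V ≃ₗ[K] V' := LinearEquiv.ofFinrankEq V V' hV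
  let k : W ≃ₗ[K] W' := LinearEquiv.ofFinrankEq W W' hW
  obtain ⟨g, hg⟩ := Submodule.exists_linearEquiv_restrict_eq
    ((e₀.submoduleMap W).symm ≪≫ₗ k)
  have hk (w : W) : g (e₀ w) = k w := by
    rw [← LinearEquiv.submoduleMap_apply, ← hg]
    simp
  refine ⟨e₀ ≪≫ₗ g, le_antisymm ?_ fun y hy ↦ ?_⟩
  · rintro _ ⟨x, hx, rfl⟩
    exact (hk ⟨x, hx⟩).symm ▸ (k ⟨x, hx⟩).2
  · exact ⟨k.symm ⟨y, hy⟩, (k.symm ⟨y, hy⟩).2, by simp [hk]⟩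

open Module in
/-- In a nondegenerate quadratic space with a totally singular subspace of half the dimension,
the orthogonal group acts transitively on totally singular subspaces of a given dimension. -/
theorem QuadraticForm.exists_isometryEquiv_map_eq_of_totally_singular
    {K V : Type*} [Field K] [AddCommGroup V] [Module K V] [FiniteDimensional K V]
    {Q : QuadraticForm K V} (hQ : Q.polarBilin.Nondegenerate)
    {U : Submodule K V} (hU : ∀ u ∈ U, Q u = 0) (hUV : 2 * finrank K U = finrank K V)
    {W₁ W₂ : Submodule K V} (h₁ : ∀ w ∈ W₁, Q w = 0) (h₂ : ∀ w ∈ W₂, Q w = 0)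
    (hrank : finrank K W₁ = finrank K W₂) :
    ∃ g : Q.IsometryEquiv Q, W₁.map (g.toLinearEquiv : V →ₗ[K] V) = W₂ := by
  obtain ⟨U₁, hWU₁, hU₁, hr₁⟩ := exists_totally_singular_ge_of_finrank hQ hU hUV h₁
  obtain ⟨U₂, hWU₂, hU₂, hr₂⟩ := exists_totally_singular_ge_of_finrank hQ hU hUV h₂
  obtain ⟨Φ₁, hΦ₁⟩ := exists_dualProd_isometryEquiv_of_finrank hQ hU₁ (by omega)
  obtain ⟨Φ₂, hΦ₂⟩ := exists_dualProd_isometryEquiv_of_finrank hQ hU₂ (by omega)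
  obtain ⟨e, he⟩ := Submodule.exists_linearEquiv_map_eq_of_finrank_eq (hr₁.trans hr₂.symm)
    (W₁.submoduleOf U₁) (W₂.submoduleOf U₂) (by
      rw [(Submodule.submoduleOfEquivOfLe hWU₁).finrank_eq,
        (Submodule.submoduleOfEquivOfLe hWU₂).finrank_eq, hrank])
  let g : Q.IsometryEquiv Q := (Φ₁.symm.trans (dualProdIsometry e)).trans Φ₂
  have hg (u : U₁) : g u = e u := by
    have h : Φ₁.symm u = (0, u) := by
      rw [← hΦ₁ u]
      exact Φ₁.toLinearEquiv.symm_apply_apply _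
    change Φ₂ (dualProdIsometry e (Φ₁.symm u)) = e u
    rw [h, ← hΦ₂]
    exact congrArg Φ₂ (Prod.ext (map_zero e.dualMap.symm) rfl)
  refine ⟨g, Submodule.eq_of_le_of_finrank_eq ?_ ?_⟩
  · rintro _ ⟨x, hx, rfl⟩
    have hmem : e ⟨x, hWU₁ hx⟩ ∈ W₂.submoduleOf U₂ := he ▸ Submodule.mem_map_of_mem hx
    exact (hg ⟨x, hWU₁ hx⟩).symm ▸ hmem
  · rw [LinearEquiv.finrank_map_eq, hrank]

/-- The orthogonal group of a nondegenerate plus-type quadratic form on a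
10-dimensional `ZMod 2`-vector space acts transitively on totally singular subspaces of any
fixed dimension. -/
theorem orthogonal_group_transitive_on_totally_singular_subspaces
    {V : Type*} [AddCommGroup V] [Module (ZMod 2) V] [Module.Finite (ZMod 2) V]
    (Q : QuadraticForm (ZMod 2) V)
    (hdim : Module.finrank (ZMod 2) V = 10)
    (hnd : ∀ x : V, (∀ y : V, QuadraticMap.polar Q x y = 0) → x = 0)
    (hplus : ∃ W : Submodule (ZMod 2) V,
      (∀ w ∈ W, Q w = 0) ∧ Module.finrank (ZMod 2) W = 5)
    (W1 W2 : Submodule (ZMod 2) V)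
    (h1 : ∀ w ∈ W1, Q w = 0) (h2 : ∀ w ∈ W2, Q w = 0)
    (hrank : Module.finrank (ZMod 2) W1 = Module.finrank (ZMod 2) W2) :
    ∃ g : V ≃ₗ[ZMod 2] V, (∀ v : V, Q (g v) = Q v) ∧
      W1.map (g : V →ₗ[ZMod 2] V) = W2 := by
  obtain ⟨U, hU, hUdim⟩ := hplus
  have hQ : Q.polarBilin.Nondegenerate := LinearMap.BilinForm.Nondegenerate.ofSeparatingLeft hnd
  obtain ⟨g, hg⟩ := QuadraticForm.exists_isometryEquiv_map_eq_of_totally_singular hQ hU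
    (by omega) h1 h2 hrank
  exact ⟨g.toLinearEquiv, g.map_app, hg⟩
end

section
/- Let V be a 10-dimensional vector space over the field F2 = ZMod 2 and Q a quadratic form on V whose polar bilinear form is nondegenerate, and suppose Q is of plus type. Let O(V,Q)' denote the commutator subgroup of the orthogonal group O(V,Q). Then for every i with 0 ≤ i ≤ 4 and any two i-dimensional totally singular subspaces W1, W2 of V, there exists g ∈ O(V,Q)' with g(W1) = W2 (i.e., O(V,Q)' acts transitively on i-dimensional totally singular subspaces for i ≤ 4). -/
/-- The orthogonal group of a quadratic form `Q`, as a subgroup of the group of linear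
automorphisms of `V`. -/
def orthogonalSubgroup {V : Type*} [AddCommGroup V] [Module (ZMod 2) V]
    (Q : QuadraticForm (ZMod 2) V) : Subgroup (V ≃ₗ[ZMod 2] V) where
  carrier := {g | ∀ v : V, Q (g v) = Q v}
  one_mem' := fun _ => rfl
  mul_mem' := by
    intro a b ha hb v
    have h : (a * b) v = a (b v) := rfl
    rw [h, ha, hb]
  inv_mem' := by
    intro a ha v
    have h := ha (a⁻¹ v)
    rw [show a (a⁻¹ v) = v from a.apply_symm_apply v] at h
    exact h.symm

section OrthogonalCommutator

open Module
open scoped commutatorElement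

variable {V : Type*} [AddCommGroup V] [Module (ZMod 2) V] {Q : QuadraticForm (ZMod 2) V}

namespace QuadraticMap

lemma zmod_two_eq_zero_of_ne_one {a : ZMod 2} (h : a ≠ 1) : a = 0 := by
  revert a; decide

lemma polar_self_eq_zero_of_zmod_two (x : V) : polar Q x x = 0 := by
  rw [polar_self, two_nsmul, CharTwo.add_self_eq_zero]

lemma map_add_of_zmod_two (x y : V) : Q (x + y) = Q x + Q y + polar Q x y :=
  QuadraticMap.map_add Q x y

lemma polar_eq_zero_of_totally_singular {W : Submodule (ZMod 2) V} (hW : ∀ w ∈ W, Q w = 0)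
    {x y : V} (hx : x ∈ W) (hy : y ∈ W) : polar Q x y = 0 := by
  simp [polar, hW _ (W.add_mem hx hy), hW _ hx, hW _ hy]

variable (Q) in
/-- The orthogonal transvection `x ↦ x - B(v, x) v` over `𝔽₂`; it is an isometry when `Q v = 1`. -/
def transvection (v : V) : V ≃ₗ[ZMod 2] V :=
  reflection (x := v) (f := Q.polarBilin v) <| by
    rw [polarBilin_apply_apply, polar_self_eq_zero_of_zmod_two]; rfl

lemma transvection_apply (v x : V) : Q.transvection v x = x - polar Q v x • v :=
  reflection_apply ..

lemma transvection_inv (v : V) : (Q.transvection v)⁻¹ = Q.transvection v := rfl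

lemma transvection_mem_orthogonalSubgroup {v : V} (hv : Q v = 1) :
    Q.transvection v ∈ orthogonalSubgroup Q := by
  intro x
  rw [transvection_apply, sub_eq_add_neg, ← neg_smul, map_add_of_zmod_two, QuadraticMap.map_smul,
    polar_smul_right, hv, polar_comm Q x v]
  generalize polar Q v x = b
  generalize Q x = a
  revert a b
  decide

variable [Module.Finite (ZMod 2) V]

/-- The orthogonal complement of a totally singular subspace of less than half the dimension
is not totally singular. -/
lemma exists_polar_eq_zero_and_map_eq_one (hnd : ∀ x, (∀ y, polar Q x y = 0) → x = 0)
    {W : Submodule (ZMod 2) V} (hdim : 2 * finrank (ZMod 2) W < finrank (ZMod 2) V) :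
    ∃ s, (∀ w ∈ W, polar Q w s = 0) ∧ Q s = 1 := by
  by_contra! h
  let B : LinearMap.BilinForm (ZMod 2) V := Q.polarBilin
  have hrefl : B.IsRefl := fun x y hxy ↦ by
    rw [← hxy]; exact polar_comm Q y x
  have hB : B.Nondegenerate :=
    ⟨hnd, fun x hx ↦ hnd x fun y ↦ by rw [polar_comm]; exact hx y⟩
  have hsing : ∀ s ∈ B.orthogonal W, Q s = 0 := fun s hs ↦
    zmod_two_eq_zero_of_ne_one (h s hs)
  have hle : B.orthogonal W ≤ B.orthogonal (B.orthogonal W) := fun s hs t ht ↦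
    polar_eq_zero_of_totally_singular hsing ht hs
  have hcard := Submodule.finrank_mono hle
  rw [LinearMap.BilinForm.orthogonal_orthogonal hB hrefl,
    LinearMap.BilinForm.finrank_orthogonal hB] at hcard
  omega

/-- A commutator of transvections which agrees with the transvection along `x + y` on `W`. -/
lemma exists_commutator_apply_eq (hnd : ∀ x, (∀ y, polar Q x y = 0) → x = 0)
    {W : Submodule (ZMod 2) V} (hdim : 2 * finrank (ZMod 2) W < finrank (ZMod 2) V)
    (hW : ∀ w ∈ W, Q w = 0) {x y : V} (hx : x ∈ W) (hy : Q y = 0) (hxy : polar Q x y = 1) :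
    ∃ g ∈ ⁅orthogonalSubgroup Q, orthogonalSubgroup Q⁆,
      g x = y ∧ ∀ u ∈ W, polar Q u y = 0 → g u = u := by
  obtain ⟨s, hsW, hs⟩ : ∃ s, (∀ w ∈ W, polar Q s w = 0) ∧ Q s = 1 ∧ polar Q s y = 1 := by
    obtain ⟨s, hsW, hs⟩ := exists_polar_eq_zero_and_map_eq_one hnd hdim
    by_cases hsy : polar Q s y = 1
    · exact ⟨s, fun w hw ↦ by rw [polar_comm, hsW w hw], hs, hsy⟩
    · have hsy : polar Q s y = 0 := zmod_two_eq_zero_of_ne_one hsy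
      refine ⟨s + x, fun w hw ↦ ?_, ?_, ?_⟩
      · rw [polar_add_left, polar_comm Q s, hsW w hw, polar_eq_zero_of_totally_singular hW hx hw,
          add_zero]
      · rw [map_add_of_zmod_two, hs, hW x hx, polar_comm, hsW x hx, add_zero, add_zero]
      · rw [polar_add_left, hsy, hxy, zero_add]
  obtain ⟨hs, hsy⟩ := hs
  have hsx := hsW x hx
  have hss := polar_self_eq_zero_of_zmod_two (Q := Q) s
  have hxx := polar_self_eq_zero_of_zmod_two (Q := Q) x
  have hyy := polar_self_eq_zero_of_zmod_two (Q := Q) y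
  have hxs := polar_comm Q s x ▸ hsx
  have hys := polar_comm Q s y ▸ hsy
  have hyx := polar_comm Q x y ▸ hxy
  have hQ : Q (s + (x + y)) = 1 := by
    rw [map_add_of_zmod_two, map_add_of_zmod_two, polar_add_right, hs, hW x hx, hy, hxy, hsx, hsy]
    decide
  refine ⟨⁅Q.transvection (s + (x + y)), Q.transvection s⁆,
    Subgroup.commutator_mem_commutator (transvection_mem_orthogonalSubgroup hQ)
      (transvection_mem_orthogonalSubgroup hs), ?_, fun u hu huy ↦ ?_⟩
  · simp only [commutatorElement_def, transvection_inv, LinearEquiv.mul_apply, transvection_apply,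
      polar_add_left, polar_add_right, polar_sub_right, polar_smul_right, hss, hxx, hyy, hsx, hxs,
      hsy, hys, hxy, hyx]
    match_scalars <;> decide
  · have hyu := polar_comm Q u y ▸ huy
    have hxu := polar_eq_zero_of_totally_singular hW hx hu
    simp [commutatorElement_def, transvection_inv, LinearEquiv.mul_apply, transvection_apply,
      polar_add_left, hyu, hxu, hsW u hu]

lemma exists_commutator_finrank_inf_lt (hnd : ∀ x, (∀ y, polar Q x y = 0) → x = 0)
    {W₁ W₂ : Submodule (ZMod 2) V} (hdim : 2 * finrank (ZMod 2) W₁ < finrank (ZMod 2) V)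
    (h₁ : ∀ w ∈ W₁, Q w = 0) (h₂ : ∀ w ∈ W₂, Q w = 0)
    (hrank : finrank (ZMod 2) W₁ = finrank (ZMod 2) W₂) (hne : W₁ ≠ W₂) :
    ∃ g ∈ ⁅orthogonalSubgroup Q, orthogonalSubgroup Q⁆,
      finrank (ZMod 2) ↥(W₁ ⊓ W₂) <
        finrank (ZMod 2) ↥(W₁.map (g : V →ₗ[ZMod 2] V) ⊓ W₂) := by
  suffices h : ∃ g ∈ ⁅orthogonalSubgroup Q, orthogonalSubgroup Q⁆, ∃ x ∈ W₁, g x ∈ W₂ ∧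
      g x ∉ W₁ ∧ ∀ u ∈ W₁ ⊓ W₂, g u = u by
    obtain ⟨g, hg, x, hx, hgx, hgx', hfix⟩ := h
    refine ⟨g, hg, Submodule.finrank_lt_finrank_of_lt <| SetLike.lt_iff_le_and_exists.2
      ⟨fun u hu ↦ ⟨⟨u, hu.1, hfix u hu⟩, hu.2⟩, g x, ⟨⟨x, hx, rfl⟩, hgx⟩, fun h ↦ hgx' h.1⟩⟩
  by_cases hperp : ∃ x ∈ W₁, ∃ y ∈ W₂, polar Q x y = 1
  · obtain ⟨x, hx, y, hy, hxy⟩ := hperp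
    obtain ⟨g, hg, rfl, hfix⟩ := exists_commutator_apply_eq hnd hdim h₁ hx (h₂ y hy) hxy
    refine ⟨g, hg, x, hx, hy, fun hmem ↦ ?_, fun u hu ↦
      hfix u hu.1 (polar_eq_zero_of_totally_singular h₂ hu.2 hy)⟩
    rw [polar_eq_zero_of_totally_singular h₁ hx hmem] at hxy
    exact zero_ne_one hxy
  push Not at hperp
  obtain ⟨x, hx, hx₂⟩ : ∃ x ∈ W₁, x ∉ W₂ :=
    SetLike.not_le_iff_exists.1 fun h ↦ hne (Submodule.eq_of_le_of_finrank_eq h hrank)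
  obtain ⟨y, hy, hy₁⟩ : ∃ y ∈ W₂, y ∉ W₁ :=
    SetLike.not_le_iff_exists.1 fun h ↦ hne (Submodule.eq_of_le_of_finrank_eq h hrank.symm).symm
  have hxy : polar Q x y = 0 := zmod_two_eq_zero_of_ne_one (hperp x hx y hy)
  obtain ⟨z, hz, hxz, hyz, hUz⟩ : ∃ z, Q z = 0 ∧ polar Q x z = 1 ∧ polar Q z y = 1 ∧
      ∀ u ∈ W₁ ⊓ W₂, polar Q u z = 0 := by
    have hnot : x ∉ (W₁ ⊓ W₂) ⊔ Submodule.span (ZMod 2) {x + y} := by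
      intro h
      obtain ⟨u, hu, v, hv, huv⟩ := Submodule.mem_sup.1 h
      obtain ⟨a, rfl⟩ := Submodule.mem_span_singleton.1 hv
      by_cases ha : a = 1
      · subst ha
        refine hy₁ ?_
        rw [one_smul] at huv
        have : y = -u := eq_neg_of_add_eq_zero_left <| by
          rwa [add_left_comm, add_eq_left, add_comm] at huv
        exact this ▸ W₁.neg_mem hu.1
      · obtain rfl : a = 0 := zmod_two_eq_zero_of_ne_one ha
        rw [zero_smul, add_zero] at huv
        exact hx₂ (huv ▸ hu.2)
    obtain ⟨f, hfx, hf⟩ := Submodule.exists_le_ker_of_notMem hnot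
    have hfx : f x = 1 := Fin.eq_one_of_ne_zero _ hfx
    have hB : LinearMap.BilinForm.Nondegenerate (Q.polarBilin : LinearMap.BilinForm (ZMod 2) V) :=
      ⟨hnd, fun x hx ↦ hnd x fun y ↦ by rw [polar_comm]; exact hx y⟩
    obtain ⟨z, rfl⟩ := (LinearMap.BilinForm.toDual _ hB).surjective f
    simp only [LinearMap.BilinForm.toDual_def, polarBilin_apply_apply] at hfx
    have hzU : ∀ u ∈ W₁ ⊓ W₂, polar Q z u = 0 := fun u hu ↦ hf (Submodule.mem_sup_left hu)
    have hzxy : polar Q z (x + y) = 0 :=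
      hf (Submodule.mem_sup_right (Submodule.mem_span_singleton_self _))
    have hzy : polar Q z y = 1 := by
      rw [polar_add_right, hfx] at hzxy
      exact (CharTwo.add_eq_zero.1 hzxy).symm
    by_cases hz : Q z = 0
    · exact ⟨z, hz, polar_comm Q z x ▸ hfx, hzy, fun u hu ↦ polar_comm Q z u ▸ hzU u hu⟩
    · have hz : Q z = 1 := Fin.eq_one_of_ne_zero _ hz
      refine ⟨z + x, ?_, ?_, ?_, fun u hu ↦ ?_⟩
      · rw [map_add_of_zmod_two, hz, h₁ x hx, hfx]; decide
      · rw [polar_add_right, polar_comm Q x z, hfx, polar_self_eq_zero_of_zmod_two, add_zero]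
      · rw [polar_add_left, hzy, hxy, add_zero]
      · rw [polar_add_right, polar_comm Q u z, hzU u hu,
          polar_eq_zero_of_totally_singular h₁ hu.1 hx, add_zero]
  obtain ⟨g, hg, rfl, hgfix⟩ := exists_commutator_apply_eq hnd hdim h₁ hx hz hxz
  have hgO : g ∈ orthogonalSubgroup Q := Subgroup.commutator_le_self _ hg
  obtain ⟨g', hg', rfl, hgfix'⟩ := exists_commutator_apply_eq hnd
    (W := W₁.map (g : V →ₗ[ZMod 2] V)) (by rwa [LinearEquiv.finrank_map_eq])
    (by rintro _ ⟨w, hw, rfl⟩; exact (hgO w).trans (h₁ w hw)) ⟨x, hx, rfl⟩ (h₂ y hy) hyz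
  refine ⟨g' * g, mul_mem hg' hg, x, hx, hy, hy₁, fun u hu ↦ ?_⟩
  have hgu : g u = u := hgfix u hu.1 (hUz u hu)
  rw [LinearEquiv.mul_apply, hgu]
  exact hgfix' u ⟨u, hu.1, hgu⟩ (polar_eq_zero_of_totally_singular h₂ hu.2 hy)

/-- The commutator subgroup of the orthogonal group of a nondegenerate quadratic form over `𝔽₂`
is transitive on totally singular subspaces of a given dimension less than half of `dim V`. -/
theorem exists_commutator_map_eq (hnd : ∀ x, (∀ y, polar Q x y = 0) → x = 0)
    {W₁ W₂ : Submodule (ZMod 2) V} (hdim : 2 * finrank (ZMod 2) W₁ < finrank (ZMod 2) V)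
    (h₁ : ∀ w ∈ W₁, Q w = 0) (h₂ : ∀ w ∈ W₂, Q w = 0)
    (hrank : finrank (ZMod 2) W₁ = finrank (ZMod 2) W₂) :
    ∃ g ∈ ⁅orthogonalSubgroup Q, orthogonalSubgroup Q⁆, W₁.map (g : V →ₗ[ZMod 2] V) = W₂ := by
  induction hn : finrank (ZMod 2) W₂ - finrank (ZMod 2) ↥(W₁ ⊓ W₂) using Nat.strong_induction_on
    generalizing W₁ with
  | _ n ih =>
  by_cases hne : W₁ = W₂
  · exact ⟨1, one_mem _, hne ▸ Submodule.map_id W₁⟩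
  obtain ⟨g, hg, hlt⟩ := exists_commutator_finrank_inf_lt hnd hdim h₁ h₂ hrank hne
  have hgO : g ∈ orthogonalSubgroup Q := Subgroup.commutator_le_self _ hg
  have hmap : finrank (ZMod 2) (W₁.map (g : V →ₗ[ZMod 2] V)) = finrank (ZMod 2) W₁ :=
    LinearEquiv.finrank_map_eq g W₁
  have hle : finrank (ZMod 2) ↥(W₁.map (g : V →ₗ[ZMod 2] V) ⊓ W₂) ≤ finrank (ZMod 2) W₂ :=
    Submodule.finrank_mono inf_le_right
  obtain ⟨g', hg', h⟩ := ih _ (by omega) (W₁ := W₁.map (g : V →ₗ[ZMod 2] V)) (by rwa [hmap])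
    (by rintro _ ⟨w, hw, rfl⟩; exact (hgO w).trans (h₁ w hw)) (hmap.trans hrank) rfl
  exact ⟨g' * g, mul_mem hg' hg, by rw [← h, ← Submodule.map_comp]; rfl⟩

end QuadraticMap

end OrthogonalCommutator


/-- The commutator subgroup of the orthogonal group of a nondegenerate plus-type
quadratic form on a 10-dimensional `ZMod 2`-vector space acts transitively on `i`-dimensional
totally singular subspaces for every `i ≤ 4`. -/
theorem commutator_transitive_on_totally_singular_subspaces_of_dim_le_four
    {V : Type*} [AddCommGroup V] [Module (ZMod 2) V] [Module.Finite (ZMod 2) V]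
    (Q : QuadraticForm (ZMod 2) V)
    (hdim : Module.finrank (ZMod 2) V = 10)
    (hnd : ∀ x : V, (∀ y : V, QuadraticMap.polar Q x y = 0) → x = 0)
    (hplus : ∃ W : Submodule (ZMod 2) V,
      (∀ w ∈ W, Q w = 0) ∧ Module.finrank (ZMod 2) W = 5)
    (i : ℕ) (hi : i ≤ 4)
    (W1 W2 : Submodule (ZMod 2) V)
    (h1 : ∀ w ∈ W1, Q w = 0) (h2 : ∀ w ∈ W2, Q w = 0)
    (hd1 : Module.finrank (ZMod 2) W1 = i) (hd2 : Module.finrank (ZMod 2) W2 = i) :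
    ∃ g ∈ ⁅orthogonalSubgroup Q, orthogonalSubgroup Q⁆,
      W1.map (g : V →ₗ[ZMod 2] V) = W2 := by
  exact QuadraticMap.exists_commutator_map_eq hnd (by omega) h1 h2 (hd1.trans hd2.symm)
end

section
/- Let V be a 10-dimensional vector space over the field F2 = ZMod 2 and Q a quadratic form on V whose polar bilinear form is nondegenerate, and suppose Q is of plus type. Then the set of 5-dimensional totally singular subspaces of V decomposes into exactly two orbits under the action of the commutator subgroup O(V,Q)' of the orthogonal group: there exist 5-dimensional totally singular subspaces W1, W2 lying in different O(V,Q)'-orbits, and every 5-dimensional totally singular subspace lies in the O(V,Q)'-orbit of W1 or of W2. -/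
namespace OrthogonalF2

open Module
open scoped commutatorElement

variable {V : Type*} [AddCommGroup V] [Module (ZMod 2) V]

lemma zmod_two_eq_one_of_ne_zero {c : ZMod 2} (h : c ≠ 0) : c = 1 := by
  revert c; decide

lemma polar_self_eq_zero (Q : QuadraticForm (ZMod 2) V) (v : V) : QuadraticMap.polar Q v v = 0 := by
  rw [QuadraticMap.polar_self, ZModModule.char_nsmul_eq_zero]

lemma map_add_polar (Q : QuadraticForm (ZMod 2) V) (x y : V) :
    Q (x + y) = Q x + Q y + QuadraticMap.polar Q x y := by
  simp [QuadraticMap.polar]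

/-- The orthogonal transvection `x ↦ x + B(v, x) v`, an isometry when `Q v = 1`. -/
def transvection (Q : QuadraticForm (ZMod 2) V) (v : V) : V ≃ₗ[ZMod 2] V :=
  Module.reflection (x := v) (f := Q.polarBilin v) (polar_self_eq_zero Q v)

variable {Q : QuadraticForm (ZMod 2) V}

lemma transvection_apply (v x : V) :
    transvection Q v x = x + QuadraticMap.polar Q v x • v := by
  rw [← ZModModule.sub_eq_add]
  exact Module.reflection_apply _ _

lemma transvection_mul_self (v : V) : transvection Q v * transvection Q v = 1 :=
  LinearEquiv.ext fun x => Module.involutive_reflection _ x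

lemma transvection_apply_of_polar_eq_zero {v x : V} (h : QuadraticMap.polar Q v x = 0) :
    transvection Q v x = x := by
  rw [transvection_apply, h, zero_smul, add_zero]

lemma transvection_apply_of_polar_eq_one {v x : V} (h : QuadraticMap.polar Q v x = 1) :
    transvection Q v x = x + v := by
  rw [transvection_apply, h, one_smul]

lemma transvection_mem {v : V} (hv : Q v = 1) : transvection Q v ∈ orthogonalSubgroup Q := by
  intro x
  by_cases h : QuadraticMap.polar Q v x = 0
  · rw [transvection_apply_of_polar_eq_zero h]
  · have h := zmod_two_eq_one_of_ne_zero h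
    rw [transvection_apply_of_polar_eq_one h, map_add_polar, QuadraticMap.polar_comm, h, hv,
      add_assoc, show (1 : ZMod 2) + 1 = 0 from rfl, add_zero]

lemma polar_map {g : V ≃ₗ[ZMod 2] V} (hg : g ∈ orthogonalSubgroup Q) (x y : V) :
    QuadraticMap.polar Q (g x) (g y) = QuadraticMap.polar Q x y := by
  have hg : ∀ v, Q (g v) = Q v := hg
  simp only [QuadraticMap.polar, ← map_add, hg]

lemma conj_transvection {g : V ≃ₗ[ZMod 2] V} (hg : g ∈ orthogonalSubgroup Q) (v : V) :
    g * transvection Q v * g⁻¹ = transvection Q (g v) := by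
  rw [mul_inv_eq_iff_eq_mul]
  ext x
  simp only [LinearEquiv.mul_apply, transvection_apply, map_add, map_smul, polar_map hg]

lemma map_mul_eq (g h : V ≃ₗ[ZMod 2] V) (W : Submodule (ZMod 2) V) :
    W.map ((g * h : V ≃ₗ[ZMod 2] V) : V →ₗ[ZMod 2] V) =
      (W.map (h : V →ₗ[ZMod 2] V)).map (g : V →ₗ[ZMod 2] V) :=
  Submodule.map_comp _ _ _

lemma map_one_eq (W : Submodule (ZMod 2) V) :
    W.map ((1 : V ≃ₗ[ZMod 2] V) : V →ₗ[ZMod 2] V) = W :=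
  Submodule.map_id _

lemma transvection_map_map (v : V) (W : Submodule (ZMod 2) V) :
    (W.map (transvection Q v : V →ₗ[ZMod 2] V)).map (transvection Q v : V →ₗ[ZMod 2] V) = W := by
  rw [← map_mul_eq, transvection_mul_self, map_one_eq]

variable (Q) in
/-- A totally singular subspace of half the dimension of the ambient space. -/
structure IsLagrangian (W : Submodule (ZMod 2) V) : Prop where
  singular : ∀ w ∈ W, Q w = 0
  finrank_eq : finrank (ZMod 2) V = 2 * finrank (ZMod 2) W

lemma IsLagrangian.map {W : Submodule (ZMod 2) V} (hW : IsLagrangian Q W)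
    {g : V ≃ₗ[ZMod 2] V} (hg : g ∈ orthogonalSubgroup Q) :
    IsLagrangian Q (W.map (g : V →ₗ[ZMod 2] V)) where
  singular := by
    rintro _ ⟨w, hw, rfl⟩
    exact (hg w).trans (hW.singular w hw)
  finrank_eq := by
    rw [LinearEquiv.finrank_map_eq]
    exact hW.finrank_eq

lemma IsLagrangian.polar_eq_zero {W : Submodule (ZMod 2) V} (hW : IsLagrangian Q W)
    {x y : V} (hx : x ∈ W) (hy : y ∈ W) : QuadraticMap.polar Q x y = 0 := by
  simp [QuadraticMap.polar, hW.singular _ hx, hW.singular _ hy,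
    hW.singular _ (W.add_mem hx hy)]

lemma polarBilin_isRefl (Q : QuadraticForm (ZMod 2) V) :
    LinearMap.BilinForm.IsRefl Q.polarBilin := fun x y h =>
  (QuadraticMap.polar_comm Q y x).trans h

lemma polarBilin_nondegenerate (hnd : ∀ x : V, (∀ y : V, QuadraticMap.polar Q x y = 0) → x = 0) :
    LinearMap.BilinForm.Nondegenerate Q.polarBilin :=
  ⟨hnd, fun x hx => hnd x fun y => (QuadraticMap.polar_comm Q x y).trans (hx y)⟩

lemma exists_polar_eq_one (hnd : ∀ x : V, (∀ y : V, QuadraticMap.polar Q x y = 0) → x = 0)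
    {v : V} (hv : v ≠ 0) : ∃ x, QuadraticMap.polar Q x v = 1 := by
  by_contra! h
  refine hv (hnd v fun y => ?_)
  rw [QuadraticMap.polar_comm]
  by_contra hne
  exact h y (zmod_two_eq_one_of_ne_zero hne)

variable (Q) in
/-- The product of the transvections along the vectors of a list. -/
def transvectionProd (l : List V) : V ≃ₗ[ZMod 2] V :=
  (l.map (transvection Q)).prod

lemma transvectionProd_nil : transvectionProd Q [] = 1 := rfl

lemma transvectionProd_cons (v : V) (l : List V) :
    transvectionProd Q (v :: l) = transvection Q v * transvectionProd Q l := by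
  simp [transvectionProd]

lemma transvectionProd_mem {l : List V} (hl : ∀ v ∈ l, Q v = 1) :
    transvectionProd Q l ∈ orthogonalSubgroup Q :=
  Subgroup.list_prod_mem _ fun _ hg => by
    obtain ⟨v, hv, rfl⟩ := List.mem_map.1 hg
    exact transvection_mem (hl v hv)

lemma exists_mem_apply_eq_of_polar_eq_one {v w : V} (hv : Q v = 1) (hw : Q w = 1)
    (h : QuadraticMap.polar Q v w = 1) : ∃ g ∈ orthogonalSubgroup Q, g v = w := by
  have hvw : Q (v + w) = 1 := by
    rw [map_add_polar, hv, hw, h]; rfl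
  refine ⟨transvection Q (v + w), transvection_mem hvw, ?_⟩
  rw [transvection_apply_of_polar_eq_one, ← add_assoc, ZModModule.add_self, zero_add]
  rw [QuadraticMap.polar_add_left, polar_self_eq_zero, QuadraticMap.polar_comm, h, zero_add]

lemma ne_zero_of_nonsingular {v : V} (hv : Q v = 1) : v ≠ 0 := by
  rintro rfl
  simp at hv

variable [Module.Finite (ZMod 2) V]

lemma IsLagrangian.orthogonal_eq
    (hnd : ∀ x : V, (∀ y : V, QuadraticMap.polar Q x y = 0) → x = 0)
    {W : Submodule (ZMod 2) V} (hW : IsLagrangian Q W) :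
    LinearMap.BilinForm.orthogonal Q.polarBilin W = W := by
  have hle : W ≤ LinearMap.BilinForm.orthogonal Q.polarBilin W :=
    fun x hx y hy => hW.polar_eq_zero hy hx
  refine (Submodule.eq_of_le_of_finrank_eq hle ?_).symm
  rw [LinearMap.BilinForm.finrank_orthogonal (polarBilin_nondegenerate hnd), hW.finrank_eq]
  lia

lemma IsLagrangian.exists_polar_eq_one
    (hnd : ∀ x : V, (∀ y : V, QuadraticMap.polar Q x y = 0) → x = 0)
    {W : Submodule (ZMod 2) V} (hW : IsLagrangian Q W) {b : V} (hb : b ∉ W) :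
    ∃ a ∈ W, QuadraticMap.polar Q a b = 1 := by
  by_contra! h
  refine hb ((hW.orthogonal_eq hnd).le fun a ha => ?_)
  by_contra hne
  exact h a ha (zmod_two_eq_one_of_ne_zero hne)

/-- A vector outside the sum of two Lagrangians is not orthogonal to their intersection. -/
lemma IsLagrangian.exists_mem_inf_polar_eq_one
    (hnd : ∀ x : V, (∀ y : V, QuadraticMap.polar Q x y = 0) → x = 0)
    {W W' : Submodule (ZMod 2) V} (hW : IsLagrangian Q W) (hW' : IsLagrangian Q W')
    {v : V} (hv : v ∉ W ⊔ W') : ∃ z ∈ W ⊓ W', QuadraticMap.polar Q v z = 1 := by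
  by_contra! h
  refine hv ?_
  rw [← LinearMap.BilinForm.orthogonal_orthogonal (polarBilin_nondegenerate hnd)
    (polarBilin_isRefl Q) (W ⊔ W')]
  intro z hz
  have hzW : z ∈ W := (hW.orthogonal_eq hnd).le fun y hy => hz y (Submodule.mem_sup_left hy)
  have hzW' : z ∈ W' := (hW'.orthogonal_eq hnd).le fun y hy => hz y (Submodule.mem_sup_right hy)
  refine (QuadraticMap.polar_comm Q z v).trans ?_
  by_contra hne
  exact h z ⟨hzW, hzW'⟩ (zmod_two_eq_one_of_ne_zero hne)

lemma IsLagrangian.finrank_inf_map_transvection_of_mem_sup {W W' : Submodule (ZMod 2) V}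
    (hW : IsLagrangian Q W) (hW' : IsLagrangian Q W') {v : V} (hv : Q v = 1) (h : v ∈ W ⊔ W') :
    finrank (ZMod 2) ↥(W ⊓ W'.map (transvection Q v : V →ₗ[ZMod 2] V)) =
      finrank (ZMod 2) ↥(W ⊓ W') + 1 := by
  obtain ⟨a, ha, b, hb, rfl⟩ := Submodule.mem_sup.1 h
  have hab : QuadraticMap.polar Q a b = 1 := by
    rw [map_add_polar, hW.singular a ha, hW'.singular b hb] at hv
    simpa using hv
  have hvb : QuadraticMap.polar Q (a + b) b = 1 := by
    rw [QuadraticMap.polar_add_left, hab, polar_self_eq_zero, add_zero]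
  have htb : transvection Q (a + b) b = a := by
    rw [transvection_apply_of_polar_eq_one hvb, add_left_comm, ZModModule.add_self, add_zero]
  have haW' : a ∉ W ⊓ W' := fun h => by
    rw [hW'.polar_eq_zero h.2 hb] at hab
    exact zero_ne_one hab
  rw [← Submodule.finrank_sup_span_singleton haW']
  suffices W ⊓ W'.map (transvection Q (a + b) : V →ₗ[ZMod 2] V) =
      W ⊓ W' ⊔ Submodule.span (ZMod 2) {a} by rw [this]
  apply le_antisymm
  · rintro x ⟨hxW, y, hy, rfl⟩
    simp only [LinearEquiv.coe_coe, SetLike.mem_coe] at hxW hy ⊢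
    by_cases h0 : QuadraticMap.polar Q (a + b) y = 0
    · rw [transvection_apply_of_polar_eq_zero h0] at hxW ⊢
      exact Submodule.mem_sup_left ⟨hxW, hy⟩
    · have h1 := zmod_two_eq_one_of_ne_zero h0
      rw [transvection_apply_of_polar_eq_one h1] at hxW ⊢
      rw [add_left_comm, add_comm] at hxW ⊢
      exact Submodule.add_mem_sup ⟨(W.add_mem_iff_left ha).1 hxW, W'.add_mem hy hb⟩
        (Submodule.mem_span_singleton_self a)
  · refine sup_le ?_ ?_
    · rintro x ⟨hxW, hxW'⟩
      refine ⟨hxW, x, hxW', transvection_apply_of_polar_eq_zero ?_⟩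
      rw [QuadraticMap.polar_add_left, hW.polar_eq_zero ha hxW, hW'.polar_eq_zero hb hxW',
        add_zero]
    · rw [Submodule.span_singleton_le_iff_mem]
      exact ⟨ha, b, hb, htb⟩

/-- A transvection changes the parity of the dimension of the intersection with a fixed
Lagrangian. -/
lemma IsLagrangian.finrank_inf_map_transvection
    (hnd : ∀ x : V, (∀ y : V, QuadraticMap.polar Q x y = 0) → x = 0)
    {W W' : Submodule (ZMod 2) V} (hW : IsLagrangian Q W) (hW' : IsLagrangian Q W')
    {v : V} (hv : Q v = 1) :
    (finrank (ZMod 2) ↥(W ⊓ W'.map (transvection Q v : V →ₗ[ZMod 2] V)) : ZMod 2) =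
      finrank (ZMod 2) ↥(W ⊓ W') + 1 := by
  by_cases h : v ∈ W ⊔ W'
  · rw [hW.finrank_inf_map_transvection_of_mem_sup hW' hv h, Nat.cast_add_one]
  · obtain ⟨z, ⟨hzW, hzW'⟩, hz⟩ := hW.exists_mem_inf_polar_eq_one hnd hW' h
    have hz' : z + v ∈ W'.map (transvection Q v : V →ₗ[ZMod 2] V) :=
      ⟨z, hzW', transvection_apply_of_polar_eq_one hz⟩
    have hv' : v ∈ W ⊔ W'.map (transvection Q v : V →ₗ[ZMod 2] V) := by
      have := Submodule.add_mem_sup hzW hz'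
      rwa [← add_assoc, ZModModule.add_self, zero_add] at this
    have := hW.finrank_inf_map_transvection_of_mem_sup (hW'.map (transvection_mem hv)) hv hv'
    rw [transvection_map_map] at this
    rw [this, Nat.cast_add_one, add_assoc, show (1 : ZMod 2) + 1 = 0 from rfl, add_zero]

lemma IsLagrangian.exists_mem_sup_of_ne
    (hnd : ∀ x : V, (∀ y : V, QuadraticMap.polar Q x y = 0) → x = 0)
    {W W' : Submodule (ZMod 2) V} (hW : IsLagrangian Q W) (hW' : IsLagrangian Q W')
    (hne : W' ≠ W) : ∃ v ∈ W ⊔ W', Q v = 1 := by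
  have hle : ¬ W' ≤ W := fun hle => hne <| Submodule.eq_of_le_of_finrank_eq hle <| by
    have := hW.finrank_eq
    have := hW'.finrank_eq
    lia
  obtain ⟨b, hb, hbW⟩ := SetLike.not_le_iff_exists.1 hle
  obtain ⟨a, ha, hab⟩ := hW.exists_polar_eq_one hnd hbW
  refine ⟨a + b, Submodule.add_mem_sup ha hb, ?_⟩
  rw [map_add_polar, hW.singular a ha, hW'.singular b hb, hab, zero_add, zero_add]

lemma IsLagrangian.finrank_inf_map_transvectionProd
    (hnd : ∀ x : V, (∀ y : V, QuadraticMap.polar Q x y = 0) → x = 0)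
    {W W' : Submodule (ZMod 2) V} (hW : IsLagrangian Q W) (hW' : IsLagrangian Q W')
    {l : List V} (hl : ∀ v ∈ l, Q v = 1) :
    (finrank (ZMod 2) ↥(W ⊓ W'.map (transvectionProd Q l : V →ₗ[ZMod 2] V)) : ZMod 2) =
      finrank (ZMod 2) ↥(W ⊓ W') + l.length := by
  induction l with
  | nil => rw [transvectionProd_nil, map_one_eq, List.length_nil, Nat.cast_zero, add_zero]
  | cons v l ih =>
    rw [List.forall_mem_cons] at hl
    rw [transvectionProd_cons, map_mul_eq, hW.finrank_inf_map_transvection hnd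
      (hW'.map (transvectionProd_mem hl.2)) hl.1, ih hl.2, List.length_cons, Nat.cast_add_one,
      add_assoc]

/-- Products of transvections act transitively on Lagrangians. -/
lemma IsLagrangian.exists_transvectionProd
    (hnd : ∀ x : V, (∀ y : V, QuadraticMap.polar Q x y = 0) → x = 0)
    {W W' : Submodule (ZMod 2) V} (hW : IsLagrangian Q W) (hW' : IsLagrangian Q W') :
    ∃ l : List V, (∀ v ∈ l, Q v = 1) ∧
      W.map (transvectionProd Q l : V →ₗ[ZMod 2] V) = W' := by
  induction h : finrank (ZMod 2) V - finrank (ZMod 2) ↥(W ⊓ W')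
    using Nat.strong_induction_on generalizing W' with
  | _ n ih =>
    by_cases hne : W' = W
    · exact ⟨[], by simp, by rw [transvectionProd_nil, map_one_eq, hne]⟩
    · obtain ⟨v, hvm, hv⟩ := hW.exists_mem_sup_of_ne hnd hW' hne
      have hrank := hW.finrank_inf_map_transvection_of_mem_sup hW' hv hvm
      have hle := Submodule.finrank_le (W ⊓ W'.map (transvection Q v : V →ₗ[ZMod 2] V))
      obtain ⟨l, hl, hlW⟩ := ih _ (by lia) (hW'.map (transvection_mem hv)) rfl
      refine ⟨v :: l, List.forall_mem_cons.2 ⟨hv, hl⟩, ?_⟩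
      rw [transvectionProd_cons, map_mul_eq, hlW, transvection_map_map]

/-- The parities of the intersection dimensions of three Lagrangians add up to that of their
common dimension. -/
lemma IsLagrangian.finrank_inf_add_finrank_inf
    (hnd : ∀ x : V, (∀ y : V, QuadraticMap.polar Q x y = 0) → x = 0)
    {A B C : Submodule (ZMod 2) V} (hA : IsLagrangian Q A) (hB : IsLagrangian Q B)
    (hC : IsLagrangian Q C) :
    (finrank (ZMod 2) ↥(A ⊓ C) : ZMod 2) + finrank (ZMod 2) ↥A =
      finrank (ZMod 2) ↥(A ⊓ B) + finrank (ZMod 2) ↥(B ⊓ C) := by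
  obtain ⟨l, hl, rfl⟩ := hB.exists_transvectionProd hnd hC
  rw [hA.finrank_inf_map_transvectionProd hnd hB hl,
    hB.finrank_inf_map_transvectionProd hnd hB hl, inf_idem]
  have : finrank (ZMod 2) ↥A = finrank (ZMod 2) ↥B := by
    have := hA.finrank_eq
    have := hB.finrank_eq
    lia
  rw [this]
  ring

/-- The Dickson invariant, computed from the action on a Lagrangian. -/
noncomputable def dickson
    (hnd : ∀ x : V, (∀ y : V, QuadraticMap.polar Q x y = 0) → x = 0)
    {W : Submodule (ZMod 2) V} (hW : IsLagrangian Q W) :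
    orthogonalSubgroup Q →* Multiplicative (ZMod 2) :=
  MonoidHom.mk'
    (fun g => .ofAdd (finrank (ZMod 2) ↥(W ⊓ W.map (g.1 : V →ₗ[ZMod 2] V)) +
      finrank (ZMod 2) ↥W)) <| by
    rintro ⟨g, hg⟩ ⟨h, hh⟩
    rw [← ofAdd_add]
    congr 1
    have key := hW.finrank_inf_add_finrank_inf hnd (hW.map hg) ((hW.map hh).map hg)
    rw [← Submodule.map_inf _ g.injective, LinearEquiv.finrank_map_eq] at key
    rw [← map_mul_eq] at key
    refine key.trans ?_
    rw [add_add_add_comm, ZModModule.add_self, add_zero]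

lemma IsLagrangian.finrank_inf_map_of_mem_commutator
    (hnd : ∀ x : V, (∀ y : V, QuadraticMap.polar Q x y = 0) → x = 0)
    {W : Submodule (ZMod 2) V} (hW : IsLagrangian Q W) {g : V ≃ₗ[ZMod 2] V}
    (hg : g ∈ ⁅orthogonalSubgroup Q, orthogonalSubgroup Q⁆) :
    (finrank (ZMod 2) ↥(W ⊓ W.map (g : V →ₗ[ZMod 2] V)) : ZMod 2) = finrank (ZMod 2) ↥W := by
  have hle : ⁅orthogonalSubgroup Q, orthogonalSubgroup Q⁆ ≤
      (dickson hnd hW).ker.map (orthogonalSubgroup Q).subtype := by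
    refine Subgroup.commutator_le.2 fun g hg h hh =>
      ⟨⁅(⟨g, hg⟩ : orthogonalSubgroup Q), ⟨h, hh⟩⁆, ?_, rfl⟩
    rw [SetLike.mem_coe, MonoidHom.mem_ker, map_commutatorElement,
      commutatorElement_eq_one_iff_mul_comm, mul_comm]
  obtain ⟨g, hg', rfl⟩ := hle hg
  have h0 : (finrank (ZMod 2) ↥(W ⊓ W.map (g.1 : V →ₗ[ZMod 2] V)) : ZMod 2) +
      finrank (ZMod 2) ↥W = 0 := Multiplicative.ofAdd.injective hg'
  rwa [← ZModModule.sub_eq_add, sub_eq_zero] at h0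

/-- In dimension above four, two nonsingular vectors have a common nonsingular vector orthogonal
to neither. -/
lemma exists_nonsingular_polar_eq_one
    (hnd : ∀ x : V, (∀ y : V, QuadraticMap.polar Q x y = 0) → x = 0)
    (hdim : 4 < finrank (ZMod 2) V) {v w : V} (hv : v ≠ 0) (hw : w ≠ 0) :
    ∃ u, Q u = 1 ∧ QuadraticMap.polar Q u v = 1 ∧ QuadraticMap.polar Q u w = 1 := by
  obtain ⟨x, hxv, hxw⟩ :
      ∃ x, QuadraticMap.polar Q x v = 1 ∧ QuadraticMap.polar Q x w = 1 := by
    obtain ⟨a, ha⟩ := exists_polar_eq_one hnd hv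
    obtain ⟨b, hb⟩ := exists_polar_eq_one hnd hw
    by_cases haw : QuadraticMap.polar Q a w = 0
    · by_cases hbv : QuadraticMap.polar Q b v = 0
      · exact ⟨a + b, by simp [QuadraticMap.polar_add_left, ha, hbv],
          by simp [QuadraticMap.polar_add_left, haw, hb]⟩
      · exact ⟨b, zmod_two_eq_one_of_ne_zero hbv, hb⟩
    · exact ⟨a, ha, zmod_two_eq_one_of_ne_zero haw⟩
  by_cases hx : Q x = 0
  swap
  · exact ⟨x, zmod_two_eq_one_of_ne_zero hx, hxv, hxw⟩
  set H := LinearMap.BilinForm.orthogonal Q.polarBilin (Submodule.span (ZMod 2) {v, w})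
  obtain ⟨y, hyH, hy⟩ : ∃ y ∈ H, Q y + QuadraticMap.polar Q x y = 1 := by
    by_contra! h
    have hH : ∀ y ∈ H, Q y = QuadraticMap.polar Q x y := fun y hy => by
      have := h y hy
      by_contra hne
      refine this (zmod_two_eq_one_of_ne_zero ?_)
      rwa [← ZModModule.sub_eq_add, sub_ne_zero]
    have hle : H ≤ LinearMap.BilinForm.orthogonal Q.polarBilin H := fun y hy z hz => by
      change Q (z + y) - Q z - Q y = 0
      rw [hH _ hy, hH _ hz, hH _ (H.add_mem hz hy), QuadraticMap.polar_add_right]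
      abel
    have h1 := Submodule.finrank_mono hle
    have h2 := LinearMap.BilinForm.finrank_orthogonal (polarBilin_nondegenerate hnd) H
    have h3 := LinearMap.BilinForm.finrank_orthogonal (polarBilin_nondegenerate hnd)
      (Submodule.span (ZMod 2) {v, w})
    have h4 : finrank (ZMod 2) (Submodule.span (ZMod 2) {v, w}) ≤ 2 := by
      classical
      have := finrank_span_finset_le_card (R := ZMod 2) ({v, w} : Finset V)
      rw [Finset.coe_pair] at this
      exact this.trans Finset.card_le_two
    change finrank (ZMod 2) H = _ at h3
    lia
  have hyv : QuadraticMap.polar Q y v = 0 :=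
    (QuadraticMap.polar_comm Q y v).trans (hyH v (Submodule.subset_span (by simp)))
  have hyw : QuadraticMap.polar Q y w = 0 :=
    (QuadraticMap.polar_comm Q y w).trans (hyH w (Submodule.subset_span (by simp)))
  refine ⟨x + y, ?_, ?_, ?_⟩
  · rw [map_add_polar, hx, zero_add, hy]
  · rw [QuadraticMap.polar_add_left, hxv, hyv, add_zero]
  · rw [QuadraticMap.polar_add_left, hxw, hyw, add_zero]

/-- In dimension above four, the orthogonal group is transitive on nonsingular vectors. -/
lemma exists_mem_apply_eq
    (hnd : ∀ x : V, (∀ y : V, QuadraticMap.polar Q x y = 0) → x = 0)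
    (hdim : 4 < finrank (ZMod 2) V) {v w : V} (hv : Q v = 1) (hw : Q w = 1) :
    ∃ g ∈ orthogonalSubgroup Q, g v = w := by
  obtain ⟨u, hu, huv, huw⟩ := exists_nonsingular_polar_eq_one hnd hdim
    (ne_zero_of_nonsingular hv) (ne_zero_of_nonsingular hw)
  obtain ⟨g, hg, rfl⟩ := exists_mem_apply_eq_of_polar_eq_one hv hu
    ((QuadraticMap.polar_comm Q v u).trans huv)
  obtain ⟨h, hh, rfl⟩ := exists_mem_apply_eq_of_polar_eq_one hu hw huw
  exact ⟨h * g, mul_mem hh hg, rfl⟩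

lemma transvection_mul_transvection_mem_commutator
    (hnd : ∀ x : V, (∀ y : V, QuadraticMap.polar Q x y = 0) → x = 0)
    (hdim : 4 < finrank (ZMod 2) V) {v w : V} (hv : Q v = 1) (hw : Q w = 1) :
    transvection Q v * transvection Q w ∈ ⁅orthogonalSubgroup Q, orthogonalSubgroup Q⁆ := by
  obtain ⟨g, hg, rfl⟩ := exists_mem_apply_eq hnd hdim hv hw
  have hinv : (transvection Q v)⁻¹ = transvection Q v :=
    inv_eq_of_mul_eq_one_left (transvection_mul_self v)
  have := Subgroup.commutator_mem_commutator (transvection_mem hv) hg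
  rwa [commutatorElement_def, hinv, mul_assoc, mul_assoc, ← mul_assoc g,
    conj_transvection hg] at this

lemma transvectionProd_mem_commutator
    (hnd : ∀ x : V, (∀ y : V, QuadraticMap.polar Q x y = 0) → x = 0)
    (hdim : 4 < finrank (ZMod 2) V) :
    ∀ l : List V, (∀ v ∈ l, Q v = 1) → Even l.length →
      transvectionProd Q l ∈ ⁅orthogonalSubgroup Q, orthogonalSubgroup Q⁆
  | [], _, _ => one_mem _
  | [v], _, h => by simp at h
  | v :: w :: l, hl, h => by
    simp only [List.forall_mem_cons] at hl
    rw [transvectionProd_cons, transvectionProd_cons, ← mul_assoc]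
    refine mul_mem (transvection_mul_transvection_mem_commutator hnd hdim hl.1 hl.2.1)
      (transvectionProd_mem_commutator hnd hdim l hl.2.2 ?_)
    simpa [parity_simps] using h

lemma exists_nonsingular (hnd : ∀ x : V, (∀ y : V, QuadraticMap.polar Q x y = 0) → x = 0)
    (hdim : 4 < finrank (ZMod 2) V) : ∃ v, Q v = 1 := by
  have := Module.nontrivial_of_finrank_pos (R := ZMod 2) (M := V) (by lia)
  obtain ⟨x, hx⟩ := exists_ne (0 : V)
  obtain ⟨u, hu, -⟩ := exists_nonsingular_polar_eq_one hnd hdim hx hx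
  exact ⟨u, hu⟩

end OrthogonalF2

/-- For a nondegenerate plus-type quadratic form on a 10-dimensional
`ZMod 2`-vector space, the 5-dimensional totally singular subspaces split into exactly two
orbits under the commutator subgroup of the orthogonal group. -/
theorem commutator_two_orbits_on_maximal_totally_singular_subspaces
    {V : Type*} [AddCommGroup V] [Module (ZMod 2) V] [Module.Finite (ZMod 2) V]
    (Q : QuadraticForm (ZMod 2) V)
    (hdim : Module.finrank (ZMod 2) V = 10)
    (hnd : ∀ x : V, (∀ y : V, QuadraticMap.polar Q x y = 0) → x = 0)
    (hplus : ∃ W : Submodule (ZMod 2) V,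
      (∀ w ∈ W, Q w = 0) ∧ Module.finrank (ZMod 2) W = 5) :
    ∃ W1 W2 : Submodule (ZMod 2) V,
      (∀ w ∈ W1, Q w = 0) ∧ Module.finrank (ZMod 2) W1 = 5 ∧
      (∀ w ∈ W2, Q w = 0) ∧ Module.finrank (ZMod 2) W2 = 5 ∧
      (¬ ∃ g ∈ ⁅orthogonalSubgroup Q, orthogonalSubgroup Q⁆,
        W1.map (g : V →ₗ[ZMod 2] V) = W2) ∧
      ∀ W : Submodule (ZMod 2) V, (∀ w ∈ W, Q w = 0) →
        Module.finrank (ZMod 2) W = 5 →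
        (∃ g ∈ ⁅orthogonalSubgroup Q, orthogonalSubgroup Q⁆,
          W1.map (g : V →ₗ[ZMod 2] V) = W) ∨
        (∃ g ∈ ⁅orthogonalSubgroup Q, orthogonalSubgroup Q⁆,
          W2.map (g : V →ₗ[ZMod 2] V) = W) := by
  open OrthogonalF2 in
  obtain ⟨W1, hs1, hr1⟩ := hplus
  have hdim4 : 4 < Module.finrank (ZMod 2) V := by lia
  have hW1 : IsLagrangian Q W1 := ⟨hs1, by lia⟩
  obtain ⟨v, hv⟩ := exists_nonsingular hnd hdim4
  have hW2 := hW1.map (transvection_mem hv)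
  refine ⟨W1, W1.map (transvection Q v : V →ₗ[ZMod 2] V), hs1, hr1, hW2.singular,
    by have := hW2.finrank_eq; lia, ?_, fun W hs hr => ?_⟩
  · rintro ⟨g, hg, h⟩
    have h1 := hW1.finrank_inf_map_of_mem_commutator hnd hg
    rw [h, hW1.finrank_inf_map_transvection hnd hW1 hv, inf_idem] at h1
    simp at h1
  · have hW : IsLagrangian Q W := ⟨hs, by lia⟩
    obtain ⟨l, hl, hlW⟩ := hW1.exists_transvectionProd hnd hW
    rcases Nat.even_or_odd l.length with he | ho
    · exact .inl ⟨_, transvectionProd_mem_commutator hnd hdim4 l hl he, hlW⟩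
    · refine .inr ⟨_, transvectionProd_mem_commutator hnd hdim4 (l ++ [v]) ?_ ?_, ?_⟩
      · simpa [or_imp, forall_and, hv] using hl
      · simpa [parity_simps] using ho
      · have hmul : transvectionProd Q (l ++ [v]) = transvectionProd Q l * transvection Q v := by
          simp [transvectionProd]
        rw [hmul, map_mul_eq, transvection_map_map, hlW]
end

section
/- Let V be a 10-dimensional vector space over the field F2 = ZMod 2 and Q a quadratic form on V whose polar bilinear form is nondegenerate, and suppose Q is of plus type. Then the orthogonal group O(V,Q) has exactly three orbits on V: the orbit {0}, the set of nonzero singular vectors (vectors v ≠ 0 with Q(v) = 0), which has exactly 527 elements, and the set of nonsingular vectors (vectors v with Q(v) = 1), which has exactly 496 elements. -/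
open QuadraticMap in
theorem polarBilin_isRefl {V : Type*} [AddCommGroup V] [Module (ZMod 2) V]
    (Q : QuadraticForm (ZMod 2) V) : LinearMap.BilinForm.IsRefl Q.polarBilin := by
  intro x y h
  rw [polarBilin_apply_apply] at h ⊢
  rw [polar_comm, h]

theorem polarBilin_nondegenerate {V : Type*} [AddCommGroup V] [Module (ZMod 2) V]
    {Q : QuadraticForm (ZMod 2) V}
    (hnd : ∀ x : V, (∀ y : V, QuadraticMap.polar Q x y = 0) → x = 0) :
    LinearMap.BilinForm.Nondegenerate Q.polarBilin :=
  ⟨fun x hx => hnd x hx,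
    fun x hx => hnd x fun y => by rw [QuadraticMap.polar_comm]; exact hx y⟩

theorem eq_one_of_ne_zero_zmod_two {a : ZMod 2} : a ≠ 0 → a = 1 := by
  revert a; decide

open QuadraticMap in
/-- The transvection in a nonsingular vector `a` is an isometry. -/
theorem exists_mem_orthogonalSubgroup_transvection
    {V : Type*} [AddCommGroup V] [Module (ZMod 2) V]
    (Q : QuadraticForm (ZMod 2) V) {a : V} (ha : Q a = 1) :
    ∃ g ∈ orthogonalSubgroup Q, ∀ v, g v = v + polar Q v a • a := by
  let f : V →ₗ[ZMod 2] V := LinearMap.id + (Q.polarBilin.flip a).smulRight a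
  have hf : ∀ v, f v = v + polar Q v a • a := fun v => rfl
  have hpa : polar Q a a = 0 := by
    rw [polar_self, ha]; decide
  have hinv : Function.Involutive f := by
    intro v
    simp only [hf, polar_add_left, polar_smul_left, hpa]
    rw [smul_zero, add_zero, add_assoc, ← add_smul, CharTwo.add_self_eq_zero, zero_smul, add_zero]
  refine ⟨LinearEquiv.ofInvolutive f hinv, fun v => ?_, hf⟩
  change Q (f v) = Q v
  rw [hf, QuadraticMap.map_add Q, QuadraticMap.map_smul, ha, polar_smul_right]
  simp only [smul_eq_mul]
  generalize polar Q v a = c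
  generalize Q v = d
  revert c d; decide

open QuadraticMap in
theorem exists_mem_orthogonalSubgroup_of_polar_eq_one
    {V : Type*} [AddCommGroup V] [Module (ZMod 2) V]
    (Q : QuadraticForm (ZMod 2) V) {v w : V} (hQ : Q v = Q w) (hvw : polar Q v w = 1) :
    ∃ g ∈ orthogonalSubgroup Q, g v = w := by
  have ha : Q (v + w) = 1 := by
    rw [QuadraticMap.map_add Q, hQ, hvw, CharTwo.add_self_eq_zero, zero_add]
  obtain ⟨g, hg, h⟩ := exists_mem_orthogonalSubgroup_transvection Q ha
  refine ⟨g, hg, ?_⟩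
  have h2 : ∀ x : V, x + x = 0 := fun x => by
    rw [← two_smul (ZMod 2) x, show (2 : ZMod 2) = 0 from rfl, zero_smul]
  have hvv : polar Q v v = 0 := by
    rw [polar_self, two_smul, CharTwo.add_self_eq_zero]
  rw [h, polar_add_right, hvw, hvv, zero_add, one_smul, ← add_assoc, h2, zero_add]

open QuadraticMap in
theorem exists_polar_eq_one_and_polar_eq_one
    {V : Type*} [AddCommGroup V] [Module (ZMod 2) V] {Q : QuadraticForm (ZMod 2) V}
    (hnd : ∀ x : V, (∀ y : V, polar Q x y = 0) → x = 0)
    {v w : V} (hv : v ≠ 0) (hw : w ≠ 0) :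
    ∃ u, polar Q v u = 1 ∧ polar Q w u = 1 := by
  have key : ∀ x : V, x ≠ 0 → ∃ y, polar Q x y = 1 := by
    intro x hx
    by_contra! h
    exact hx (hnd x fun y => by_contra fun hy => h y (eq_one_of_ne_zero_zmod_two hy))
  obtain ⟨a, ha⟩ := key v hv
  obtain ⟨b, hb⟩ := key w hw
  by_cases hwa : polar Q w a = 0
  · by_cases hvb : polar Q v b = 0
    · exact ⟨a + b, by rw [polar_add_right, ha, hvb, add_zero],
        by rw [polar_add_right, hb, hwa, zero_add]⟩
    · exact ⟨b, eq_one_of_ne_zero_zmod_two hvb, hb⟩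
  · exact ⟨a, ha, eq_one_of_ne_zero_zmod_two hwa⟩

open QuadraticMap in
theorem exists_polar_eq_one_of_five_le_finrank
    {V : Type*} [AddCommGroup V] [Module (ZMod 2) V] [Module.Finite (ZMod 2) V]
    {Q : QuadraticForm (ZMod 2) V} (hdim : 5 ≤ Module.finrank (ZMod 2) V)
    (hnd : ∀ x : V, (∀ y : V, polar Q x y = 0) → x = 0) (v w : V) :
    ∃ x y, polar Q v x = 0 ∧ polar Q w x = 0 ∧ polar Q v y = 0 ∧ polar Q w y = 0 ∧
      polar Q x y = 1 := by
  have hB := polarBilin_nondegenerate hnd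
  set S : Submodule (ZMod 2) V := Submodule.span (ZMod 2) {v, w}
  set P := LinearMap.BilinForm.orthogonal Q.polarBilin S
  have hS : Module.finrank (ZMod 2) S ≤ 2 :=
by
    classical
    have h := (finrank_span_finset_le_card (R := ZMod 2) ({v, w} : Finset V)).trans
      Finset.card_le_two
    rwa [Finset.coe_pair] at h
  have hP := LinearMap.BilinForm.finrank_orthogonal hB S
  have hPS := LinearMap.BilinForm.orthogonal_orthogonal hB (polarBilin_isRefl Q) S
  have hle : ¬ P ≤ S := fun h => by
    have := Submodule.finrank_mono h
    change Module.finrank (ZMod 2) P = _ at hP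
    omega
  rw [← hPS] at hle
  obtain ⟨y, hy, hy'⟩ := Set.not_subset.1 hle
  simp only [SetLike.mem_coe, LinearMap.BilinForm.mem_orthogonal_iff, not_forall] at hy hy'
  obtain ⟨x, hx, hxy⟩ := hy'
  have hvS : v ∈ S := Submodule.subset_span (by simp)
  have hwS : w ∈ S := Submodule.subset_span (by simp)
  exact ⟨x, y, hx v hvS, hx w hwS, hy v hvS, hy w hwS, eq_one_of_ne_zero_zmod_two hxy⟩

open QuadraticMap in
/-- Witt's theorem for vectors: nonzero vectors of equal value are conjugate. -/
theorem exists_mem_orthogonalSubgroup_apply_eq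
    {V : Type*} [AddCommGroup V] [Module (ZMod 2) V] [Module.Finite (ZMod 2) V]
    {Q : QuadraticForm (ZMod 2) V} (hdim : 5 ≤ Module.finrank (ZMod 2) V)
    (hnd : ∀ x : V, (∀ y : V, polar Q x y = 0) → x = 0)
    {v w : V} (hv : v ≠ 0) (hw : w ≠ 0) (hQ : Q v = Q w) :
    ∃ g ∈ orthogonalSubgroup Q, g v = w := by
  obtain ⟨u, hvu, hwu⟩ := exists_polar_eq_one_and_polar_eq_one hnd hv hw
  obtain ⟨x, y, hvx, hwx, hvy, hwy, hxy⟩ := exists_polar_eq_one_of_five_le_finrank hdim hnd v w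
  have hz : ∃ z, polar Q v z = 1 ∧ polar Q w z = 1 ∧ Q z = Q v := by
    by_contra! h
    have h0 := h u hvu hwu
    have h1 := h (u + x) (by rw [polar_add_right, hvu, hvx, add_zero])
      (by rw [polar_add_right, hwu, hwx, add_zero])
    have h2 := h (u + y) (by rw [polar_add_right, hvu, hvy, add_zero])
      (by rw [polar_add_right, hwu, hwy, add_zero])
    have h3 := h (u + x + y) (by simp only [polar_add_right, hvu, hvx, hvy, add_zero])
      (by simp only [polar_add_right, hwu, hwx, hwy, add_zero])
    simp only [QuadraticMap.map_add Q, polar_add_left, hxy] at h1 h2 h3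
    have hparity : ∀ a p q c : ZMod 2, a ≠ c → a + p ≠ c → a + q ≠ c → a + p + q + 1 ≠ c →
        False := by
      decide
    refine hparity (Q u) (Q x + polar Q u x) (Q y + polar Q u y) (Q v) h0 ?_ ?_ ?_
    · rwa [← add_assoc]
    · rwa [← add_assoc]
    · simpa only [add_assoc] using h3
  obtain ⟨z, hvz, hwz, hzv⟩ := hz
  obtain ⟨g, hg, hgv⟩ := exists_mem_orthogonalSubgroup_of_polar_eq_one Q hzv.symm hvz
  obtain ⟨g', hg', hgz⟩ := exists_mem_orthogonalSubgroup_of_polar_eq_one Q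
    (hzv.trans hQ) ((polar_comm Q z w).trans hwz)
  exact ⟨g' * g, mul_mem hg' hg, (congrArg g' hgv).trans hgz⟩

/-- The nontrivial additive character of `ZMod 2`, with values in `ℤ`. -/
def signZModTwo (a : ZMod 2) : ℤ := if a = 0 then 1 else -1

theorem signZModTwo_add : ∀ a b, signZModTwo (a + b) = signZModTwo a * signZModTwo b := by
  decide

theorem sum_signZModTwo_eq_zero {W : Type*} [AddCommGroup W] [Module (ZMod 2) W] [Fintype W]
    {f : W →ₗ[ZMod 2] ZMod 2} (hf : f ≠ 0) : ∑ w, signZModTwo (f w) = 0 := by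
  obtain ⟨a, ha⟩ : ∃ a, f a ≠ 0 := by
    by_contra! h
    exact hf (LinearMap.ext h)
  have h := Equiv.sum_comp (Equiv.addRight a) fun w => signZModTwo (f w)
  simp only [Equiv.coe_addRight, map_add, signZModTwo_add, eq_one_of_ne_zero_zmod_two ha,
    ← Finset.sum_mul, show signZModTwo 1 = -1 from rfl] at h
  linarith

open QuadraticMap in
/-- If `W` is a totally singular subspace equal to its own orthogonal complement, then the excess
of singular over nonsingular vectors is the cardinality of `W`. -/
theorem sum_signZModTwo_quadraticForm
    {V : Type*} [AddCommGroup V] [Module (ZMod 2) V] [Fintype V]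
    (Q : QuadraticForm (ZMod 2) V) (W : Submodule (ZMod 2) V) (hW : ∀ w ∈ W, Q w = 0)
    (horth : LinearMap.BilinForm.orthogonal Q.polarBilin W = W) :
    ∑ v, signZModTwo (Q v) = Nat.card W := by
  classical
  have hcard : (0 : ℤ) < Fintype.card W := by exact_mod_cast Fintype.card_pos
  rw [Nat.card_eq_fintype_card]
  refine mul_left_cancel₀ hcard.ne' ?_
  have hinner (v : V) : ∑ w : W, signZModTwo (Q (v + w)) =
      if v ∈ W then (Fintype.card W : ℤ) else 0 := by
    have h (w : W) : signZModTwo (Q (v + w)) =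
        signZModTwo (Q v) * signZModTwo ((Q.polarBilin v).domRestrict W w) := by
      rw [QuadraticMap.map_add Q, hW w w.2, add_zero, signZModTwo_add]; rfl
    have hmem : v ∈ W ↔ (Q.polarBilin v).domRestrict W = 0 := by
      rw [← horth, LinearMap.BilinForm.mem_orthogonal_iff, horth, LinearMap.ext_iff, Subtype.forall]
      exact forall₂_congr fun w _ => by
        change polar Q w v = 0 ↔ polar Q v w = 0
        rw [polar_comm]
    simp only [h, ← Finset.mul_sum]
    split_ifs with hv
    · rw [hmem.1 hv, hW v hv]
      simp [signZModTwo]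
    · rw [sum_signZModTwo_eq_zero (fun h0 => hv (hmem.2 h0)), mul_zero]
  calc (Fintype.card W : ℤ) * ∑ v, signZModTwo (Q v)
      = ∑ w : W, ∑ v, signZModTwo (Q (v + w)) := by
        have h (w : W) : ∑ v, signZModTwo (Q (v + w)) = ∑ v, signZModTwo (Q v) :=
          Equiv.sum_comp (Equiv.addRight (w : V)) fun v => signZModTwo (Q v)
        simp only [h, Finset.sum_const, Finset.card_univ, nsmul_eq_mul]
    _ = ∑ v, ∑ w : W, signZModTwo (Q (v + w)) := Finset.sum_comm
    _ = (Fintype.card W : ℤ) * Fintype.card W := by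
        simp only [hinner]
        rw [← Finset.sum_filter, Finset.sum_const, nsmul_eq_mul, Fintype.card_subtype]

/-- The numbers of singular and nonsingular vectors of a plus-type form in dimension `10`. -/
theorem ncard_singular_and_ncard_nonsingular
    {V : Type*} [AddCommGroup V] [Module (ZMod 2) V] [Module.Finite (ZMod 2) V]
    (Q : QuadraticForm (ZMod 2) V) (hdim : Module.finrank (ZMod 2) V = 10)
    (hnd : ∀ x : V, (∀ y : V, QuadraticMap.polar Q x y = 0) → x = 0)
    (W : Submodule (ZMod 2) V) (hW : ∀ w ∈ W, Q w = 0)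
    (hWdim : Module.finrank (ZMod 2) W = 5) :
    Set.ncard {v : V | Q v = 0} = 528 ∧ Set.ncard {v : V | Q v = 1} = 496 := by
  classical
  have : Finite V := Module.finite_of_finite (ZMod 2)
  have := Fintype.ofFinite V
  have horth : LinearMap.BilinForm.orthogonal Q.polarBilin W = W := by
    refine (Submodule.eq_of_le_of_finrank_eq (fun w hw n hn => ?_) ?_).symm
    · change QuadraticMap.polar Q n w = 0
      rw [QuadraticMap.polar, hW _ (add_mem hn hw), hW n hn, hW w hw]
      simp
    · rw [LinearMap.BilinForm.finrank_orthogonal (polarBilin_nondegenerate hnd), hdim, hWdim]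
  have hsum := sum_signZModTwo_quadraticForm Q W hW horth
  have hWcard : Nat.card W = 32 := by
    rw [Module.natCard_eq_pow_finrank (K := ZMod 2), hWdim, Nat.card_zmod]; norm_num
  have hVcard : Fintype.card V = 1024 := by
    rw [Module.card_eq_pow_finrank (K := ZMod 2), hdim, ZMod.card]; norm_num
  have hne (v : V) : ¬ Q v = 0 ↔ Q v = 1 := by
    generalize Q v = a
    revert a; decide
  have hpart := Finset.card_filter_add_card_filter_not (s := (Finset.univ : Finset V))
    (fun v => Q v = 0)
  simp only [signZModTwo, Finset.sum_ite, Finset.sum_const, hne, nsmul_eq_mul, hWcard] at hsum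
  simp only [hne, Finset.card_univ, hVcard] at hpart
  rw [Set.ncard_eq_toFinset_card', Set.ncard_eq_toFinset_card']
  simp only [Set.toFinset_ofPred]
  push_cast at hsum
  omega

/-- The orthogonal group of a nondegenerate plus-type quadratic form on a
10-dimensional `ZMod 2`-vector space has exactly three orbits on vectors: `{0}`, the 527
nonzero singular vectors, and the 496 nonsingular vectors. -/
theorem orthogonal_group_three_orbits_on_vectors
    {V : Type*} [AddCommGroup V] [Module (ZMod 2) V] [Module.Finite (ZMod 2) V]
    (Q : QuadraticForm (ZMod 2) V)
    (hdim : Module.finrank (ZMod 2) V = 10)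
    (hnd : ∀ x : V, (∀ y : V, QuadraticMap.polar Q x y = 0) → x = 0)
    (hplus : ∃ W : Submodule (ZMod 2) V,
      (∀ w ∈ W, Q w = 0) ∧ Module.finrank (ZMod 2) W = 5) :
    Set.ncard {v : V | v ≠ 0 ∧ Q v = 0} = 527 ∧
    Set.ncard {v : V | Q v = 1} = 496 ∧
    (∀ v w : V, v ≠ 0 → Q v = 0 → w ≠ 0 → Q w = 0 →
      ∃ g ∈ orthogonalSubgroup Q, g v = w) ∧
    (∀ v w : V, Q v = 1 → Q w = 1 →
      ∃ g ∈ orthogonalSubgroup Q, g v = w) := by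
  obtain ⟨W, hW, hWdim⟩ := hplus
  obtain ⟨h0, h1⟩ := ncard_singular_and_ncard_nonsingular Q hdim hnd W hW hWdim
  have : Finite V := Module.finite_of_finite (ZMod 2)
  have hne : ∀ v : V, Q v = 1 → v ≠ 0 := by
    rintro v hv rfl
    rw [QuadraticMap.map_zero] at hv
    exact zero_ne_one hv
  refine ⟨?_, h1, fun v w hv hQv hw hQw => ?_, fun v w hQv hQw => ?_⟩
  · have hset : {v : V | v ≠ 0 ∧ Q v = 0} = {v : V | Q v = 0} \ {0} := by
      ext v
      simp [and_comm]
    rw [hset, Set.ncard_sdiff_singleton_of_mem (s := {v : V | Q v = 0}) (QuadraticMap.map_zero Q), h0]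
  · exact exists_mem_orthogonalSubgroup_apply_eq (by omega) hnd hv hw (hQv.trans hQw.symm)
  · exact exists_mem_orthogonalSubgroup_apply_eq (by omega) hnd (hne v hQv) (hne w hQw)
      (hQv.trans hQw.symm)
end

section
/- Let M be a positive-definite lattice that is the internal orthogonal direct sum of two submodules M1 and M2 (so M1 ∩ M2 = 0, M1 + M2 = M, and B(x,y) = 0 for x ∈ M1, y ∈ M2), where M1 and M2 are both indecomposable as lattices and the ranks of M1 and M2 are distinct. Then every isometry g of M satisfies g(M1) = M1 and g(M2) = M2. -/
/-- A lattice (given by its bilinear form `B` on the module `N`) is indecomposable if whenever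
it is the internal direct sum of two mutually orthogonal submodules, one of them is zero. -/
def BilinIndecomposable {R N : Type*} [CommRing R] [AddCommGroup N] [Module R N]
    (B : LinearMap.BilinForm R N) : Prop :=
  ∀ N1 N2 : Submodule R N, N1 ⊓ N2 = ⊥ → N1 ⊔ N2 = ⊤ →
    (∀ x ∈ N1, ∀ y ∈ N2, B x y = 0) → N1 = ⊥ ∨ N2 = ⊥

/-- In a positive-definite lattice, two orthogonal decompositions have a common refinement. -/
theorem mem_sup_inf_of_orthogonal_decompositions
    {M : Type*} [AddCommGroup M] [Module ℤ M] (B : LinearMap.BilinForm ℤ M)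
    (hsymm : ∀ x y : M, B x y = B y x) (hpos : ∀ x : M, x ≠ 0 → 0 < B x x)
    {M1 M2 N1 N2 : Submodule ℤ M}
    (hM : M1 ⊔ M2 = ⊤) (hMorth : ∀ x ∈ M1, ∀ y ∈ M2, B x y = 0)
    (hN : N1 ⊔ N2 = ⊤) (hNorth : ∀ x ∈ N1, ∀ y ∈ N2, B x y = 0) (x : M) :
    x ∈ (M1 ⊓ N1 ⊔ M1 ⊓ N2) ⊔ (M2 ⊓ N1 ⊔ M2 ⊓ N2) := by
  induction hn : (B x x).toNat using Nat.strong_induction_on generalizing x with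
  | _ n ih =>
    by_cases hred : ∃ y z : M, y ≠ 0 ∧ z ≠ 0 ∧ B y z = 0 ∧ x = y + z
    · obtain ⟨y, z, hy, hz, hyz, rfl⟩ := hred
      have hzy : B z y = 0 := by rw [hsymm, hyz]
      have hy' := hpos y hy
      have hz' := hpos z hz
      have hnorm : B (y + z) (y + z) = B y y + B z z := by
        simp [hyz, hzy]
      exact add_mem (ih _ (by omega) y rfl) (ih _ (by omega) z rfl)
    · have key : ∀ {P Q : Submodule ℤ M}, P ⊔ Q = ⊤ → (∀ x ∈ P, ∀ y ∈ Q, B x y = 0) →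
          x ∈ P ∨ x ∈ Q := by
        intro P Q hPQ horth
        obtain ⟨a, ha, b, hb, hab⟩ :=
          Submodule.mem_sup.1 (hPQ ▸ Submodule.mem_top : x ∈ P ⊔ Q)
        by_cases ha0 : a = 0
        · right
          rwa [← hab, ha0, zero_add]
        by_cases hb0 : b = 0
        · left
          rwa [← hab, hb0, add_zero]
        exact (hred ⟨a, b, ha0, hb0, horth a ha b hb, hab.symm⟩).elim
      rcases key hM hMorth with h | h <;> rcases key hN hNorth with h' | h'
      · exact Submodule.mem_sup_left (Submodule.mem_sup_left ⟨h, h'⟩)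
      · exact Submodule.mem_sup_left (Submodule.mem_sup_right ⟨h, h'⟩)
      · exact Submodule.mem_sup_right (Submodule.mem_sup_left ⟨h, h'⟩)
      · exact Submodule.mem_sup_right (Submodule.mem_sup_right ⟨h, h'⟩)

/-- An indecomposable submodule that is the sum of its intersections with two orthogonal disjoint
submodules is contained in one of them. -/
theorem BilinIndecomposable.le_or_le_of_le_sup_inf
    {R M : Type*} [CommRing R] [AddCommGroup M] [Module R M] {B : LinearMap.BilinForm R M}
    {P N1 N2 : Submodule R M} (hind : BilinIndecomposable (B.restrict P))
    (hNdisj : N1 ⊓ N2 = ⊥) (hNorth : ∀ x ∈ N1, ∀ y ∈ N2, B x y = 0)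
    (hle : P ≤ P ⊓ N1 ⊔ P ⊓ N2) : P ≤ N1 ∨ P ≤ N2 := by
  have hdisj : N1.comap P.subtype ⊓ N2.comap P.subtype = ⊥ := by
    rw [← Submodule.comap_inf, hNdisj, Submodule.comap_bot, Submodule.ker_subtype]
  have hsup : N1.comap P.subtype ⊔ N2.comap P.subtype = ⊤ := by
    rw [eq_top_iff]
    rintro ⟨x, hx⟩ -
    obtain ⟨a, ha, b, hb, hab⟩ := Submodule.mem_sup.1 (hle hx)
    exact Submodule.mem_sup.2 ⟨⟨a, ha.1⟩, ha.2, ⟨b, hb.1⟩, hb.2, Subtype.ext hab⟩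
  have of_bot : ∀ {Q Q' : Submodule R M}, P ≤ P ⊓ Q ⊔ P ⊓ Q' →
      Q.comap P.subtype = ⊥ → P ≤ Q' := by
    intro Q Q' hPQ hQ
    have hbot : P ⊓ Q = ⊥ := by
      rw [← Submodule.map_comap_subtype, hQ, Submodule.map_bot]
    rw [hbot, bot_sup_eq] at hPQ
    exact hPQ.trans inf_le_right
  rcases hind _ _ hdisj hsup (fun x hx y hy => hNorth x hx y hy) with h | h
  · exact Or.inr (of_bot hle h)
  · exact Or.inl (of_bot (sup_comm (P ⊓ N1) _ ▸ hle) h)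

/-- An indecomposable orthogonal summand of a positive-definite lattice is contained in one of
the two summands of any other orthogonal decomposition. -/
theorem BilinIndecomposable.le_or_le
    {M : Type*} [AddCommGroup M] [Module ℤ M] (B : LinearMap.BilinForm ℤ M)
    (hsymm : ∀ x y : M, B x y = B y x) (hpos : ∀ x : M, x ≠ 0 → 0 < B x x)
    {M1 M2 N1 N2 : Submodule ℤ M} (hMdisj : M1 ⊓ M2 = ⊥)
    (hM : M1 ⊔ M2 = ⊤) (hMorth : ∀ x ∈ M1, ∀ y ∈ M2, B x y = 0) (hNdisj : N1 ⊓ N2 = ⊥)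
    (hN : N1 ⊔ N2 = ⊤) (hNorth : ∀ x ∈ N1, ∀ y ∈ N2, B x y = 0)
    (hind : @BilinIndecomposable ℤ ↥M1 _ _ M1.module (B.restrict M1)) :
    M1 ≤ N1 ∨ M1 ≤ N2 := by
  have hle : M1 ≤ M1 ⊓ N1 ⊔ M1 ⊓ N2 := by
    intro x hx
    obtain ⟨s, hs, t, ht, rfl⟩ := Submodule.mem_sup.1
      (mem_sup_inf_of_orthogonal_decompositions B hsymm hpos hM hMorth hN hNorth x)
    have hs1 : s ∈ M1 := (sup_le inf_le_left inf_le_left : M1 ⊓ N1 ⊔ M1 ⊓ N2 ≤ M1) hs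
    have ht2 : t ∈ M2 := (sup_le inf_le_left inf_le_left : M2 ⊓ N1 ⊔ M2 ⊓ N2 ≤ M2) ht
    have ht0 : t ∈ M1 ⊓ M2 := ⟨(Submodule.add_mem_iff_right M1 hs1).1 hx, ht2⟩
    rw [hMdisj, Submodule.mem_bot] at ht0
    rwa [ht0, add_zero]
  exact hind.le_or_le_of_le_sup_inf hNdisj hNorth hle

/-- Containments between the parts of two complementary pairs are equalities. -/
theorem eq_and_eq_of_le_of_disjoint_of_sup_eq_top
    {M : Type*} [AddCommGroup M] [Module ℤ M] {M1 M2 N1 N2 : Submodule ℤ M}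
    (hM : M1 ⊔ M2 = ⊤) (hN : N1 ⊓ N2 = ⊥) (h1 : M1 ≤ N1) (h2 : M2 ≤ N2) :
    N1 = M1 ∧ N2 = M2 := by
  have hle : ∀ {P1 P2 Q1 Q2 : Submodule ℤ M}, P1 ⊔ P2 = ⊤ → Q1 ⊓ Q2 = ⊥ → P1 ≤ Q1 →
      P2 ≤ Q2 → Q1 = P1 := by
    intro P1 P2 Q1 Q2 hP hQ hl1 hl2
    have hinf : Q1 ⊓ P2 = ⊥ := le_bot_iff.1 (hQ ▸ inf_le_inf_left Q1 hl2)
    calc Q1 = (P1 ⊔ P2) ⊓ Q1 := by rw [hP, top_inf_eq]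
      _ = P1 ⊔ P2 ⊓ Q1 := (sup_inf_assoc_of_le P2 hl1)
      _ = P1 := by rw [inf_comm, hinf, sup_bot_eq]
  exact ⟨hle hM hN h1 h2, hle (sup_comm M1 M2 ▸ hM) (inf_comm N1 N2 ▸ hN) h2 h1⟩

/-- If a positive-definite lattice `M` is the internal orthogonal direct sum of
two indecomposable sublattices `M1`, `M2` of distinct ranks, then every isometry of `M`
preserves both `M1` and `M2`. -/
theorem isometry_preserves_indecomposable_orthogonal_summands
    {M : Type*} [AddCommGroup M] [Module ℤ M] [Module.Free ℤ M] [Module.Finite ℤ M]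
    (B : LinearMap.BilinForm ℤ M)
    (hsymm : ∀ x y : M, B x y = B y x)
    (hpos : ∀ x : M, x ≠ 0 → 0 < B x x)
    (M1 M2 : Submodule ℤ M)
    (hdisj : M1 ⊓ M2 = ⊥) (hsum : M1 ⊔ M2 = ⊤)
    (horth : ∀ x ∈ M1, ∀ y ∈ M2, B x y = 0)
    (hind1 : @BilinIndecomposable ℤ ↥M1 _ _ M1.module (B.restrict M1))
    (hind2 : @BilinIndecomposable ℤ ↥M2 _ _ M2.module (B.restrict M2))
    (hrank : Module.finrank ℤ M1 ≠ Module.finrank ℤ M2)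
    (g : M ≃ₗ[ℤ] M)
    (hg : ∀ x y : M, B (g x) (g y) = B x y) :
    M1.map (g : M →ₗ[ℤ] M) = M1 ∧ M2.map (g : M →ₗ[ℤ] M) = M2 := by
  have hinj : Function.Injective (g : M →ₗ[ℤ] M) := g.injective
  have hNdisj : M1.map (g : M →ₗ[ℤ] M) ⊓ M2.map (g : M →ₗ[ℤ] M) = ⊥ := by
    rw [← Submodule.map_inf _ hinj, hdisj, Submodule.map_bot]
  have hN : M1.map (g : M →ₗ[ℤ] M) ⊔ M2.map (g : M →ₗ[ℤ] M) = ⊤ := by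
    rw [← Submodule.map_sup, hsum, Submodule.map_top, LinearEquiv.range]
  have hNorth : ∀ x ∈ M1.map (g : M →ₗ[ℤ] M), ∀ y ∈ M2.map (g : M →ₗ[ℤ] M), B x y = 0 := by
    rintro _ ⟨x, hx, rfl⟩ _ ⟨y, hy, rfl⟩
    exact (hg x y).trans (horth x hx y hy)
  have eq_top : ∀ {P : Submodule ℤ M}, ⊤ ≤ P.map (g : M →ₗ[ℤ] M) → P = ⊤ := by
    intro P hP
    apply Submodule.map_injective_of_injective hinj
    rw [Submodule.map_top, LinearEquiv.range, top_le_iff.1 hP]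
  rcases BilinIndecomposable.le_or_le B hsymm hpos hdisj hsum horth hNdisj hN hNorth hind1
    with h1 | h1 <;>
  rcases BilinIndecomposable.le_or_le B hsymm hpos (inf_comm M1 M2 ▸ hdisj)
    (sup_comm M1 M2 ▸ hsum) (fun x hx y hy => (hsymm x y).trans (horth y hy x hx))
    hNdisj hN hNorth hind2 with h2 | h2
  · have h := eq_top (hsum ▸ sup_le h1 h2)
    rw [h, top_inf_eq] at hdisj
    simp [h, hdisj]
  · exact eq_and_eq_of_le_of_disjoint_of_sup_eq_top hsum hNdisj h1 h2
  · have h := (eq_and_eq_of_le_of_disjoint_of_sup_eq_top hsum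
      (inf_comm (M1.map (g : M →ₗ[ℤ] M)) _ ▸ hNdisj) h1 h2).2
    refine absurd ?_ hrank
    rw [← h]
    convert (LinearEquiv.finrank_map_eq g M1).symm <;> exact Subsingleton.elim _ _
  · have h := eq_top (hsum ▸ sup_le h1 h2)
    rw [h, inf_top_eq] at hdisj
    simp [h, hdisj]
end

section
/- Let M1 and M2 be positive-definite lattices that are both indecomposable and have distinct ranks, and let M = M1 ⊕ M2 be their orthogonal direct sum (with bilinear form B((x1,x2),(y1,y2)) = B1(x1,y1) + B2(x2,y2)). Then the natural map sending a pair (g1, g2) of isometries of M1 and M2 to the isometry g1 ⊕ g2 of M is a group isomorphism from O(M1) × O(M2) onto the isometry group O(M) of M. -/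
/-- The isometry group `O(M)` of a lattice with bilinear form `B`, as a subgroup of the group
of `ℤ`-module automorphisms of `M`. -/
def isomGroup {M : Type*} [AddCommGroup M] [Module ℤ M]
    (B : LinearMap.BilinForm ℤ M) : Subgroup (M ≃ₗ[ℤ] M) where
  carrier := {g | ∀ x y : M, B (g x) (g y) = B x y}
  one_mem' := fun _ _ => rfl
  mul_mem' := by
    intro a b ha hb x y
    have hx : (a * b) x = a (b x) := rfl
    have hy : (a * b) y = a (b y) := rfl
    rw [hx, hy, ha, hb]
  inv_mem' := by
    intro a ha x y
    have h := ha (a⁻¹ x) (a⁻¹ y)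
    rw [show a (a⁻¹ x) = x from a.apply_symm_apply x,
      show a (a⁻¹ y) = y from a.apply_symm_apply y] at h
    exact h.symm

/-- The orthogonal direct sum of two bilinear forms, on the product module. -/
def prodBilin {M1 M2 : Type*} [AddCommGroup M1] [Module ℤ M1] [AddCommGroup M2] [Module ℤ M2]
    (B1 : LinearMap.BilinForm ℤ M1) (B2 : LinearMap.BilinForm ℤ M2) :
    LinearMap.BilinForm ℤ (M1 × M2) :=
  LinearMap.mk₂ ℤ (fun x y => B1 x.1 y.1 + B2 x.2 y.2)
    (fun x x' y => by
      simp only [Prod.fst_add, Prod.snd_add, map_add, LinearMap.add_apply]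
      ring)
    (fun c x y => by
      simp [Prod.smul_fst, Prod.smul_snd, mul_add])
    (fun x y y' => by
      simp only [Prod.fst_add, Prod.snd_add, map_add]
      ring)
    (fun c x y => by
      simp [Prod.smul_fst, Prod.smul_snd, mul_add])

namespace LinearMap.BilinForm

/-- A vector is irreducible if it is not a sum of two nonzero vectors with nonnegative inner
product. -/
def IsIrreducibleVector {N : Type*} [AddCommGroup N] [Module ℤ N]
    (B : LinearMap.BilinForm ℤ N) (v : N) : Prop :=
  ∀ y z : N, v = y + z → 0 ≤ B y z → y = 0 ∨ z = 0

/-- An endomorphism is an orthogonal projection if its range is orthogonal to the range of its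
complement `1 - p`. -/
def IsOrthogonalProjection {N : Type*} [AddCommGroup N] [Module ℤ N]
    (B : LinearMap.BilinForm ℤ N) (p : N →ₗ[ℤ] N) : Prop :=
  ∀ x y : N, B (p x) (y - p y) = 0

section

variable {N : Type*} [AddCommGroup N] [Module ℤ N] {B : LinearMap.BilinForm ℤ N}

/-- The irreducible vectors of a positive definite lattice generate it. -/
theorem mem_of_forall_isIrreducibleVector (hsymm : ∀ x y : N, B x y = B y x)
    (hpos : ∀ x : N, x ≠ 0 → 0 < B x x) (S : AddSubgroup N)
    (hS : ∀ v, IsIrreducibleVector B v → v ∈ S) (v : N) : v ∈ S := by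
  induction h : (B v v).toNat using Nat.strong_induction_on generalizing v with
  | _ n ih =>
    by_cases hv : IsIrreducibleVector B v
    · exact hS v hv
    · simp only [IsIrreducibleVector, not_forall, not_or] at hv
      obtain ⟨y, z, rfl, hyz, hy, hz⟩ := hv
      have hy' := hpos y hy
      have hz' := hpos z hz
      have hsum : B (y + z) (y + z) = B y y + B z z + 2 * B y z := by
        simp only [map_add, LinearMap.add_apply, hsymm z y]
        ring
      exact S.add_mem (ih _ (by omega) y rfl) (ih _ (by omega) z rfl)

theorem IsOrthogonalProjection.apply_apply (hpos : ∀ x : N, x ≠ 0 → 0 < B x x)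
    {p : N →ₗ[ℤ] N} (hp : IsOrthogonalProjection B p) (x : N) : p (p x) = p x := by
  by_contra hne
  have hd := hpos _ (sub_ne_zero.mpr (Ne.symm hne))
  have h1 := hp x (p x)
  have h2 := hp (p x) (p x)
  simp [h1, h2] at hd

theorem IsOrthogonalProjection.apply_eq_zero_or_eq_self {p : N →ₗ[ℤ] N}
    (hp : IsOrthogonalProjection B p) {v : N} (hv : IsIrreducibleVector B v) :
    p v = 0 ∨ p v = v :=
  (hv (p v) (v - p v) (by abel) (hp v v).ge).imp_right fun h => (sub_eq_zero.mp h).symm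

/-- Any two orthogonal projections of a positive definite lattice commute. -/
theorem IsOrthogonalProjection.comm (hsymm : ∀ x y : N, B x y = B y x)
    (hpos : ∀ x : N, x ≠ 0 → 0 < B x x) {p q : N →ₗ[ℤ] N}
    (hp : IsOrthogonalProjection B p) (hq : IsOrthogonalProjection B q) (v : N) :
    p (q v) = q (p v) := by
  refine mem_of_forall_isIrreducibleVector hsymm hpos
    (LinearMap.eqLocus (p ∘ₗ q) (q ∘ₗ p)).toAddSubgroup (fun w hw => ?_) v
  change p (q w) = q (p w)
  rcases hp.apply_eq_zero_or_eq_self hw with h | h <;>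
    rcases hq.apply_eq_zero_or_eq_self hw with hqw | hqw <;> simp [h, hqw]

/-- An orthogonal projection of an indecomposable positive definite lattice is trivial. -/
theorem IsOrthogonalProjection.eq_zero_or_eq_id (hpos : ∀ x : N, x ≠ 0 → 0 < B x x)
    (hind : BilinIndecomposable B) {p : N →ₗ[ℤ] N} (hp : IsOrthogonalProjection B p) :
    (∀ x, p x = 0) ∨ ∀ x, p x = x := by
  have hidem := hp.apply_apply hpos
  refine (hind (LinearMap.range p) (LinearMap.ker p) ?_ ?_ ?_).imp (fun h x => ?_) fun h x => ?_
  · rw [eq_bot_iff]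
    rintro _ ⟨⟨x, rfl⟩, hx⟩
    rw [SetLike.mem_coe, LinearMap.mem_ker, hidem] at hx
    exact (Submodule.mem_bot ℤ).mpr hx
  · rw [eq_top_iff]
    intro x _
    refine Submodule.mem_sup.mpr ⟨p x, ⟨x, rfl⟩, x - p x, ?_, by abel⟩
    rw [LinearMap.mem_ker, map_sub, hidem, sub_self]
  · rintro _ ⟨x, rfl⟩ y hy
    simpa [LinearMap.mem_ker.mp hy] using hp x y
  · exact (Submodule.mem_bot ℤ).mp (h ▸ LinearMap.mem_range_self p x)
  · have hx : x - p x ∈ LinearMap.ker p := by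
      rw [LinearMap.mem_ker, map_sub, hidem, sub_self]
    rw [h, Submodule.mem_bot] at hx
    exact (sub_eq_zero.mp hx).symm

/-- An orthogonal projection restricts trivially to an indecomposable orthogonal summand, given
by an isometric embedding `ι` with retraction `π`. -/
theorem IsOrthogonalProjection.apply_summand {P : Type*} [AddCommGroup P] [Module ℤ P]
    {C : LinearMap.BilinForm ℤ P} (hsymm : ∀ x y : N, B x y = B y x)
    (hpos : ∀ x : N, x ≠ 0 → 0 < B x x) (hposC : ∀ x : P, x ≠ 0 → 0 < C x x)
    (hind : BilinIndecomposable C) {q : N →ₗ[ℤ] N} (hq : IsOrthogonalProjection B q)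
    (ι : P →ₗ[ℤ] N) (π : N →ₗ[ℤ] P) (hπ : ∀ x, π (ι x) = x)
    (hι : ∀ x y, B (ι x) (ι y) = C x y) (hp : IsOrthogonalProjection B (ι ∘ₗ π)) :
    (∀ x, q (ι x) = 0) ∨ ∀ x, q (ι x) = ι x := by
  have key : ∀ x, ι (π (q (ι x))) = q (ι x) := fun x => by
    simpa [hπ] using hp.comm hsymm hpos hq (ι x)
  have he : IsOrthogonalProjection C (π ∘ₗ q ∘ₗ ι) := fun x y => by
    simpa [← hι, key] using hq (ι x) (ι y)
  refine (he.eq_zero_or_eq_id hposC hind).imp (fun h x => ?_) fun h x => ?_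
  · rw [← key, show π (q (ι x)) = 0 from h x, map_zero]
  · rw [← key, show π (q (ι x)) = x from h x]

end

end LinearMap.BilinForm

/-- An additive map is linear for any `ℤ`-module structures on its source and target. -/
def AddMonoidHom.toLinearMapInt {A C : Type*} [AddCommGroup A] [Module ℤ A] [AddCommGroup C]
    [Module ℤ C] (f : A →+ C) : A →ₗ[ℤ] C where
  toFun := f
  map_add' := f.map_add
  map_smul' n x := by simpa using map_intCast_smul f ℤ ℤ n x

@[simp]
theorem AddMonoidHom.toLinearMapInt_apply {A C : Type*} [AddCommGroup A] [Module ℤ A]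
    [AddCommGroup C] [Module ℤ C] (f : A →+ C) (x : A) : f.toLinearMapInt x = f x := rfl

section OrthogonalSum

open LinearMap.BilinForm

variable {M1 M2 : Type*} [AddCommGroup M1] [Module ℤ M1] [AddCommGroup M2] [Module ℤ M2]
  {B1 : LinearMap.BilinForm ℤ M1} {B2 : LinearMap.BilinForm ℤ M2}

theorem prodBilin_apply (x y : M1 × M2) :
    prodBilin B1 B2 x y = B1 x.1 y.1 + B2 x.2 y.2 := rfl

theorem prodBilin_pos (hpos1 : ∀ x : M1, x ≠ 0 → 0 < B1 x x)
    (hpos2 : ∀ x : M2, x ≠ 0 → 0 < B2 x x) (x : M1 × M2) (hx : x ≠ 0) :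
    0 < prodBilin B1 B2 x x := by
  obtain ⟨a, b⟩ := x
  rw [prodBilin_apply]
  by_cases ha : a = 0
  · have hb : b ≠ 0 := by
      rintro rfl
      exact hx (by rw [ha]; rfl)
    simpa [ha] using hpos2 b hb
  · refine add_pos_of_pos_of_nonneg (hpos1 a ha) ?_
    by_cases hb : b = 0
    · simp [hb]
    · exact (hpos2 b hb).le

theorem isOrthogonalProjection_inl_fst :
    IsOrthogonalProjection (prodBilin B1 B2)
      ((AddMonoidHom.inl M1 M2).toLinearMapInt ∘ₗ (AddMonoidHom.fst M1 M2).toLinearMapInt) :=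
  fun x y => by simp [prodBilin_apply]

theorem isOrthogonalProjection_inr_snd :
    IsOrthogonalProjection (prodBilin B1 B2)
      ((AddMonoidHom.inr M1 M2).toLinearMapInt ∘ₗ (AddMonoidHom.snd M1 M2).toLinearMapInt) :=
  fun x y => by simp [prodBilin_apply]

/-- The conjugate of an orthogonal projection by an isometry is an orthogonal projection. -/
theorem LinearMap.BilinForm.IsOrthogonalProjection.conj {N : Type*} [AddCommGroup N] [Module ℤ N]
    {B : LinearMap.BilinForm ℤ N} {p : N →ₗ[ℤ] N} (hp : IsOrthogonalProjection B p)
    {g : N ≃ₗ[ℤ] N} (hg : g ∈ isomGroup B) :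
    IsOrthogonalProjection B (g.symm.toLinearMap ∘ₗ p ∘ₗ g.toLinearMap) := fun x y => by
  have hg' : ∀ x y, B (g x) (g y) = B x y := hg
  rw [← hg']
  simpa using hp (g x) (g y)

/-- An isometry of the orthogonal sum of two indecomposable positive definite lattices of
distinct ranks preserves each summand. -/
theorem isometry_preserves_summands
    [Module.Free ℤ M1] [Module.Finite ℤ M1] [Module.Free ℤ M2] [Module.Finite ℤ M2]
    (hsymm1 : ∀ x y : M1, B1 x y = B1 y x) (hsymm2 : ∀ x y : M2, B2 x y = B2 y x)
    (hpos1 : ∀ x : M1, x ≠ 0 → 0 < B1 x x) (hpos2 : ∀ x : M2, x ≠ 0 → 0 < B2 x x)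
    (hind1 : BilinIndecomposable B1) (hind2 : BilinIndecomposable B2)
    (hrank : Module.finrank ℤ M1 ≠ Module.finrank ℤ M2)
    {g : (M1 × M2) ≃ₗ[ℤ] (M1 × M2)} (hg : g ∈ isomGroup (prodBilin B1 B2)) :
    (∀ x : M1, (g (x, 0)).2 = 0) ∧ ∀ y : M2, (g (0, y)).1 = 0 := by
  have hsymm : ∀ x y, prodBilin B1 B2 x y = prodBilin B1 B2 y x := fun x y => by
    rw [prodBilin_apply, prodBilin_apply, hsymm1, hsymm2]
  have hpos := prodBilin_pos hpos1 hpos2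
  have hq := (isOrthogonalProjection_inl_fst (B1 := B1) (B2 := B2)).conj hg
  have h1 := hq.apply_summand hsymm hpos hpos1 hind1 (AddMonoidHom.inl M1 M2).toLinearMapInt
    (AddMonoidHom.fst M1 M2).toLinearMapInt (fun _ => rfl) (fun x y => by simp [prodBilin_apply])
    isOrthogonalProjection_inl_fst
  have h2 := hq.apply_summand hsymm hpos hpos2 hind2 (AddMonoidHom.inr M1 M2).toLinearMapInt
    (AddMonoidHom.snd M1 M2).toLinearMapInt (fun _ => rfl) (fun x y => by simp [prodBilin_apply])
    isOrthogonalProjection_inr_snd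
  simp only [LinearMap.comp_apply, LinearEquiv.coe_coe, AddMonoidHom.toLinearMapInt_apply,
    AddMonoidHom.inl_apply, AddMonoidHom.inr_apply, AddMonoidHom.coe_fst,
    LinearEquiv.symm_apply_eq, map_zero, Prod.ext_iff, Prod.fst_zero, Prod.snd_zero, and_true, true_and] at h1 h2
  have hsum : ∀ w, g w = g (w.1, 0) + g (0, w.2) := fun w => by
    rw [← map_add, Prod.mk_add_mk, add_zero, zero_add]
  rcases h1 with h1 | h1 <;> rcases h2 with h2 | h2
  · refine ⟨fun x => ?_, h2⟩
    have hx : x = 0 := by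
      have h := congrArg Prod.fst (hsum (g.symm (x, 0)))
      simpa [h1, h2] using h
    rw [hx, Prod.mk_zero_zero, map_zero, Prod.snd_zero]
  · refine absurd (le_antisymm ?_ ?_) hrank
    · refine LinearMap.finrank_le_finrank_of_injective
        (f := (AddMonoidHom.snd M1 M2).toLinearMapInt ∘ₗ g.toLinearMap ∘ₗ (AddMonoidHom.inl M1 M2).toLinearMapInt)
        ((injective_iff_map_eq_zero _).mpr fun x hx => ?_)
      have h : g (x, 0) = 0 := Prod.ext (h1 x) hx
      simpa using h
    · refine LinearMap.finrank_le_finrank_of_injective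
        (f := (AddMonoidHom.fst M1 M2).toLinearMapInt ∘ₗ g.toLinearMap ∘ₗ (AddMonoidHom.inr M1 M2).toLinearMapInt)
        ((injective_iff_map_eq_zero _).mpr fun y hy => ?_)
      have h : g (0, y) = 0 := Prod.ext hy (h2 y).symm
      simpa using h
  · exact ⟨fun x => (h1 x).symm, h2⟩
  · refine ⟨fun x => (h1 x).symm, fun y => ?_⟩
    have hy : y = 0 := by
      have h := congrArg Prod.snd (hsum (g.symm (0, y)))
      simpa [← h1, ← h2] using h
    rw [hy, Prod.mk_zero_zero, map_zero, Prod.fst_zero]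

end OrthogonalSum

/-- For positive-definite indecomposable lattices `M1`, `M2` of distinct ranks,
the map `(g1, g2) ↦ g1 ⊕ g2` is a group isomorphism from `O(M1) × O(M2)` onto the isometry
group of the orthogonal direct sum `M1 ⊕ M2`. -/
theorem isometry_group_of_orthogonal_sum
    {M1 M2 : Type*}
    [AddCommGroup M1] [Module ℤ M1] [Module.Free ℤ M1] [Module.Finite ℤ M1]
    [AddCommGroup M2] [Module ℤ M2] [Module.Free ℤ M2] [Module.Finite ℤ M2]
    (B1 : LinearMap.BilinForm ℤ M1) (B2 : LinearMap.BilinForm ℤ M2)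
    (hsymm1 : ∀ x y : M1, B1 x y = B1 y x) (hsymm2 : ∀ x y : M2, B2 x y = B2 y x)
    (hpos1 : ∀ x : M1, x ≠ 0 → 0 < B1 x x) (hpos2 : ∀ x : M2, x ≠ 0 → 0 < B2 x x)
    (hind1 : BilinIndecomposable B1) (hind2 : BilinIndecomposable B2)
    (hrank : Module.finrank ℤ M1 ≠ Module.finrank ℤ M2) :
    ∃ φ : (isomGroup B1 × isomGroup B2) ≃* isomGroup (prodBilin B1 B2),
      ∀ (g1 : isomGroup B1) (g2 : isomGroup B2) (x : M1 × M2),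
        (φ (g1, g2)).1 x = ((g1.1 x.1, g2.1 x.2) : M1 × M2) := by
  have hpres := fun {g} hg => isometry_preserves_summands hsymm1 hsymm2 hpos1 hpos2 hind1 hind2
    hrank (g := g) hg
  let ψ : isomGroup B1 × isomGroup B2 →* isomGroup (prodBilin B1 B2) :=
    { toFun := fun g =>
        ⟨{ (g.1.1.toAddEquiv.prodCongr g.2.1.toAddEquiv).toAddMonoidHom.toLinearMapInt,
            g.1.1.toAddEquiv.prodCongr g.2.1.toAddEquiv with }, fun x y =>
          congrArg₂ (· + ·) (g.1.2 x.1 y.1) (g.2.2 x.2 y.2)⟩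
      map_one' := rfl
      map_mul' := fun _ _ => rfl }
  refine ⟨MulEquiv.ofBijective ψ ⟨fun a b hab => ?_, fun ⟨g, hg⟩ => ?_⟩, fun _ _ _ => rfl⟩
  · have h : ∀ x, (ψ a).1 x = (ψ b).1 x := fun x => by rw [hab]
    refine Prod.ext (Subtype.ext (LinearEquiv.ext fun x => ?_))
      (Subtype.ext (LinearEquiv.ext fun y => ?_))
    · exact congrArg Prod.fst (h (x, 0))
    · exact congrArg Prod.snd (h (0, y))
  · obtain ⟨h1, h2⟩ := hpres hg
    obtain ⟨k1, k2⟩ := hpres (inv_mem hg)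
    have hg' : ∀ x y, prodBilin B1 B2 (g x) (g y) = prodBilin B1 B2 x y := hg
    have gl : ∀ x, ((g (x, 0)).1, (0 : M2)) = g (x, 0) := fun x => Prod.ext rfl (h1 x).symm
    have gr : ∀ y, ((0 : M1), (g (0, y)).2) = g (0, y) := fun y => Prod.ext (h2 y).symm rfl
    have gl' : ∀ x, ((g.symm (x, 0)).1, (0 : M2)) = g.symm (x, 0) :=
      fun x => Prod.ext rfl (k1 x).symm
    have gr' : ∀ y, ((0 : M1), (g.symm (0, y)).2) = g.symm (0, y) :=
      fun y => Prod.ext (k2 y).symm rfl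
    let g1 : M1 ≃ₗ[ℤ] M1 := LinearEquiv.ofLinearMap
      ((AddMonoidHom.fst M1 M2).toLinearMapInt ∘ₗ g.toLinearMap ∘ₗ
        (AddMonoidHom.inl M1 M2).toLinearMapInt)
      ((AddMonoidHom.fst M1 M2).toLinearMapInt ∘ₗ g.symm.toLinearMap ∘ₗ
        (AddMonoidHom.inl M1 M2).toLinearMapInt)
      (LinearMap.ext fun x => by simp [gl']) (LinearMap.ext fun x => by simp [gl])
    let g2 : M2 ≃ₗ[ℤ] M2 := LinearEquiv.ofLinearMap
      ((AddMonoidHom.snd M1 M2).toLinearMapInt ∘ₗ g.toLinearMap ∘ₗ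
        (AddMonoidHom.inr M1 M2).toLinearMapInt)
      ((AddMonoidHom.snd M1 M2).toLinearMapInt ∘ₗ g.symm.toLinearMap ∘ₗ
        (AddMonoidHom.inr M1 M2).toLinearMapInt)
      (LinearMap.ext fun x => by simp [gr']) (LinearMap.ext fun x => by simp [gr])
    have hg1 : g1 ∈ isomGroup B1 := fun x y => by
      change B1 (g (x, 0)).1 (g (y, 0)).1 = B1 x y
      simpa [prodBilin_apply, h1] using hg' (x, 0) (y, 0)
    have hg2 : g2 ∈ isomGroup B2 := fun x y => by
      change B2 (g (0, x)).2 (g (0, y)).2 = B2 x y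
      simpa [prodBilin_apply, h2] using hg' (0, x) (0, y)
    refine ⟨(⟨g1, hg1⟩, ⟨g2, hg2⟩), Subtype.ext (LinearEquiv.ext fun ⟨x, y⟩ => ?_)⟩
    change ((g (x, 0)).1, (g (0, y)).2) = g (x, y)
    have h : g (x, y) = g (x, 0) + g (0, y) := by
      rw [← map_add, Prod.mk_add_mk, add_zero, zero_add]
    rw [h, ← gl, ← gr, Prod.mk_add_mk, add_zero, zero_add]
end

section
/- Let n ≥ 2 and let v be a nonzero vector of the n-dimensional vector space (ZMod 2)^n over the field with two elements. Then the stabilizer of v in the general linear group GL(n, ZMod 2), i.e., the subgroup {g ∈ GL(n, ZMod 2) | g v = v}, is a maximal subgroup of GL(n, ZMod 2) (a coatom in the lattice of subgroups). -/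
/-- The stabilizer of a vector `v` in the group of invertible linear automorphisms of
`(ZMod 2)^n`. -/
def vectorStabilizer (n : ℕ) (v : Fin n → ZMod 2) :
    Subgroup ((Fin n → ZMod 2) ≃ₗ[ZMod 2] (Fin n → ZMod 2)) where
  carrier := {g | g v = v}
  one_mem' := rfl
  mul_mem' := by
    intro a b ha hb
    show (a * b) v = v
    have h : (a * b) v = a (b v) := rfl
    rw [h, hb, ha]
  inv_mem' := by
    intro a ha
    show a⁻¹ v = v
    calc a⁻¹ v = a⁻¹ (a v) := by rw [ha]
    _ = v := a.symm_apply_apply v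

/-- Any two finite linearly independent families with the same index type are related by a linear
automorphism of the ambient space. -/
theorem LinearIndependent.exists_linearEquiv_apply_eq {ι K V : Type*} [Finite ι] [DivisionRing K]
    [AddCommGroup V] [Module K V] {x y : ι → V} (hx : LinearIndependent K x)
    (hy : LinearIndependent K y) : ∃ g : V ≃ₗ[K] V, ∀ i, g (x i) = y i := by
  let f := hx.linearCombinationEquiv.symm ≪≫ₗ hy.linearCombinationEquiv
  have : FiniteDimensional K (Submodule.span K (Set.range x)) :=
    FiniteDimensional.span_of_finite K (Set.finite_range x)
  obtain ⟨g, hg⟩ := Submodule.exists_linearEquiv_restrict_eq f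
  refine ⟨g, fun i ↦ ?_⟩
  have hxi : (hx.linearCombinationEquiv (Finsupp.single i 1) : V) = x i := by simp
  rw [← hxi, ← hg]
  simp [f]

/-- Over the field with two elements, two distinct nonzero vectors are linearly independent. -/
theorem linearIndependent_pair_of_ne_zmod_two {V : Type*} [AddCommGroup V] [Module (ZMod 2) V]
    {x y : V} (hx : x ≠ 0) (hy : y ≠ 0) (hxy : x ≠ y) :
    LinearIndependent (ZMod 2) ![x, y] := by
  rw [LinearIndependent.pair_iff' hx]
  intro a
  fin_cases a
  · exact (zero_smul (ZMod 2) x).trans_ne hy.symm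
  · exact (one_smul (ZMod 2) x).trans_ne hxy

/-- For `n ≥ 2` and a nonzero vector `v` of `(ZMod 2)^n`, the stabilizer of `v`
in `GL(n, ZMod 2)` is a maximal subgroup. -/
theorem vectorStabilizer_isCoatom (n : ℕ) (hn : 2 ≤ n)
    (v : Fin n → ZMod 2) (hv : v ≠ 0) :
    IsCoatom (vectorStabilizer n v) := by
  let V := Fin n → ZMod 2
  refine ⟨fun htop ↦ ?_, fun H hH ↦ ?_⟩
  · obtain ⟨y, hy⟩ := exists_linearIndependent_pair_of_one_lt_finrank (R := ZMod 2) (M := V)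
      (by simpa [V] using Nat.lt_of_succ_le hn) hv
    obtain ⟨g, hg⟩ := hy.exists_linearEquiv_apply_eq (LinearIndependent.pair_symm_iff.mp hy)
    have hgv : g v = v := (htop ▸ Subgroup.mem_top g : g ∈ vectorStabilizer n v)
    have hgy : g v = y := hg 0
    exact hy.injective.ne (show (0 : Fin 2) ≠ 1 by decide) (hgv.symm.trans hgy)
  · obtain ⟨hle, k, hkH, hk⟩ := SetLike.lt_iff_le_and_exists.mp hH
    refine (Subgroup.eq_top_iff' H).mpr fun g ↦ ?_
    by_cases hg : g v = v
    · exact hle hg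
    have hpair (e : V ≃ₗ[ZMod 2] V) (he : e v ≠ v) : LinearIndependent (ZMod 2) ![v, e v] :=
      linearIndependent_pair_of_ne_zmod_two hv (e.map_ne_zero_iff.mpr hv) he.symm
    obtain ⟨h, hh⟩ := (hpair k hk).exists_linearEquiv_apply_eq (hpair g hg)
    have hhv : h v = v := hh 0
    have hhk : h (k v) = g v := hh 1
    have hmem : g⁻¹ * (h * k) ∈ vectorStabilizer n v := by
      change g.symm (h (k v)) = v
      rw [hhk, g.symm_apply_apply]
    have hinv := (H.mul_mem_cancel_right (H.mul_mem (hle hhv) hkH)).mp (hle hmem)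
    exact H.inv_mem_iff.mp hinv
end

section
/- Let G be a finite group such that the center Z(G) has order 2, the commutator subgroup of G equals Z(G), and g² ∈ Z(G) for every g ∈ G, and suppose |G| = 2^(2l+1) (so G is an extraspecial 2-group of order 2^(1+2l)). Then every faithful irreducible complex representation of G on a finite-dimensional complex vector space has dimension 2^l. -/
namespace Representation

open scoped commutatorElement

variable {G k V : Type*} [Group G] [Field k] [AddCommGroup V] [Module k V]

theorem isIrreducible_of_forall_submodule [Nontrivial V] (ρ : Representation k G V)
    (h : ∀ W : Submodule k V, (∀ (g : G) (v : V), v ∈ W → ρ g v ∈ W) → W = ⊥ ∨ W = ⊤) :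
    ρ.IsIrreducible where
  exists_pair_ne := ⟨⊥, ⊤, fun e ↦ bot_ne_top (α := Submodule k V)
    (congrArg Subrepresentation.toSubmodule e)⟩
  eq_bot_or_eq_top W := (h W.toSubmodule fun g _ hv ↦ W.apply_mem_toSubmodule g hv).imp
    (fun e ↦ Subrepresentation.toSubmodule_injective e)
    (fun e ↦ Subrepresentation.toSubmodule_injective e)

variable [FiniteDimensional k V] [IsAlgClosed k] (ρ : Representation k G V) [ρ.IsIrreducible]

/-- A central element acts by a scalar on an irreducible representation. -/
theorem exists_apply_eq_smul_one_of_mem_center {z : G} (hz : z ∈ Subgroup.center G) :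
    ∃ c : k, ρ z = c • 1 := by
  let f : IntertwiningMap ρ ρ :=
    { toLinearMap := ρ z
      isIntertwining' g := by
        change ρ z * ρ g = ρ g * ρ z
        rw [← map_mul, ← map_mul, Subgroup.mem_center_iff.mp hz g] }
  obtain ⟨c, hc⟩ := (IsIrreducible.algebraMap_intertwiningMap_bijective_of_isAlgClosed (ρ := ρ)).2 f
  refine ⟨c, LinearMap.ext fun v ↦ ?_⟩
  exact (congrArg (fun φ : IntertwiningMap ρ ρ ↦ φ v) hc).symm

theorem character_mul_character_inv_of_mem_center [Nontrivial V] {z : G}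
    (hz : z ∈ Subgroup.center G) :
    ρ.character z * ρ.character z⁻¹ = (Module.finrank k V : k) ^ 2 := by
  obtain ⟨c, hc⟩ := ρ.exists_apply_eq_smul_one_of_mem_center hz
  obtain ⟨d, hd⟩ := ρ.exists_apply_eq_smul_one_of_mem_center (inv_mem hz)
  have hcd : c * d = 1 := by
    have h : (c * d) • (1 : Module.End k V) = (1 : k) • 1 := by
      rw [← one_mul (1 : Module.End k V), ← smul_mul_smul_comm, ← hc, ← hd, ← map_mul,
        mul_inv_cancel, map_one, one_mul, one_smul]
    exact smul_left_injective k one_ne_zero h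
  simp only [character, hc, hd, map_smul, LinearMap.trace_one, smul_eq_mul]
  linear_combination (Module.finrank k V : k) ^ 2 * hcd

/-- If all commutators are central, the character of a faithful irreducible representation
vanishes off the center. -/
theorem character_eq_zero_of_notMem_center (hcomm : commutator G ≤ Subgroup.center G)
    (hρ : Function.Injective ρ) {g : G} (hg : g ∉ Subgroup.center G) :
    ρ.character g = 0 := by
  obtain ⟨h, hgh⟩ : ∃ h, h * g ≠ g * h := by
    simpa [Subgroup.mem_center_iff] using hg
  have hmem : ⁅h, g⁆ ∈ commutator G :=
    Subgroup.commutator_mem_commutator (Subgroup.mem_top h) (Subgroup.mem_top g)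
  obtain ⟨c, hc⟩ := ρ.exists_apply_eq_smul_one_of_mem_center (hcomm hmem)
  have hc1 : c ≠ 1 := by
    rintro rfl
    refine hgh (commutatorElement_eq_one_iff_mul_comm.mp (hρ ?_))
    rw [hc, one_smul, map_one]
  have hχ : ρ.character g = c * ρ.character g := by
    conv_lhs => rw [← ρ.char_conj g h]
    rw [show h * g * h⁻¹ = ⁅h, g⁆ * g by simp [commutatorElement_def]]
    simp [character, hc]
  exact (mul_eq_zero.mp (show (c - 1) * ρ.character g = 0 by linear_combination -hχ)).resolve_left
    (sub_ne_zero.mpr hc1)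

/-- The degree formula `|Z(G)| * d ^ 2 = |G|` for faithful irreducible representations of a finite
group all of whose commutators are central. -/
theorem card_center_mul_finrank_sq [CharZero k] [Nontrivial V] [Finite G]
    (hcomm : commutator G ≤ Subgroup.center G) (hρ : Function.Injective ρ) :
    Nat.card (Subgroup.center G) * Module.finrank k V ^ 2 = Nat.card G := by
  classical
  have := Fintype.ofFinite G
  have hG : (Nat.card G : k) ≠ 0 := Nat.cast_ne_zero.mpr Nat.card_pos.ne'
  have := invertibleOfNonzero hG
  have horth := ρ.card_inv_mul_sum_char_mul_char_eq_finrank ρ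
  rw [IsIrreducible.finrank_intertwiningMap_self, Nat.cast_one, inv_mul_eq_one₀ hG] at horth
  have hsum : ∑ g : G, ρ.character g * ρ.character g⁻¹ =
      ∑ g : G, if g ∈ Subgroup.center G then (Module.finrank k V : k) ^ 2 else 0 := by
    refine Finset.sum_congr rfl fun g _ ↦ ?_
    split_ifs with hg
    · exact ρ.character_mul_character_inv_of_mem_center hg
    · rw [ρ.character_eq_zero_of_notMem_center hcomm hρ hg, zero_mul]
  rw [hsum, ← Finset.sum_filter, Finset.sum_const, ← Fintype.card_subtype, nsmul_eq_mul,
    Fintype.card_eq_nat_card] at horth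
  exact_mod_cast horth.symm

end Representation

/-- Every faithful irreducible complex representation of an extraspecial 2-group
of order `2 ^ (1 + 2 * l)` has dimension `2 ^ l`. -/
theorem extraspecial_two_group_faithful_irreducible_dim
    {G : Type*} [Group G] [Finite G] (l : ℕ)
    (hZ : Nat.card (Subgroup.center G) = 2)
    (hcomm : commutator G = Subgroup.center G)
    (hsq : ∀ g : G, g ^ 2 ∈ Subgroup.center G)
    (hcard : Nat.card G = 2 ^ (2 * l + 1))
    (V : Type*) [AddCommGroup V] [Module ℂ V] [FiniteDimensional ℂ V] [Nontrivial V]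
    (ρ : Representation ℂ G V)
    (hfaithful : Function.Injective ρ)
    (hirr : ∀ W : Submodule ℂ V, (∀ (g : G) (v : V), v ∈ W → ρ g v ∈ W) → W = ⊥ ∨ W = ⊤) :
    Module.finrank ℂ V = 2 ^ l := by
  have := ρ.isIrreducible_of_forall_submodule hirr
  have h := ρ.card_center_mul_finrank_sq hcomm.le hfaithful
  rw [hZ, hcard] at h
  refine Nat.pow_left_injective two_ne_zero ?_
  change Module.finrank ℂ V ^ 2 = (2 ^ l) ^ 2
  rw [← pow_mul, mul_comm l 2]
  rw [pow_succ] at h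
  lia
end

section
/- Let E be a finite-dimensional real inner product space, L ⊆ E a full-rank ℤ-lattice, and L* = {x ∈ E : ⟨x,y⟩ ∈ ℤ for all y ∈ L} its dual lattice. Suppose L is 2-elementary totally even, i.e., L is even (⟨x,x⟩ ∈ 2ℤ for all x ∈ L), 2L* ⊆ L, and ⟨x,x⟩ ∈ ℤ for all x ∈ L*. Then the order of the finite quotient group L*/L is an even power of 2: there exists a natural number m with |L*/L| = 2^(2m). -/
open scoped RealInnerProductSpace

/-- The radical of an alternating `ZMod 2`-valued bi-additive form, if of finite index, has index
an even power of two. -/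
theorem AddMonoidHom.exists_index_ker_eq_two_pow_of_alternating {G : Type*} [AddCommGroup G]
    (b : G →+ G →+ ZMod 2) (halt : ∀ x, b x x = 0) (hfin : b.ker.index ≠ 0) :
    ∃ m : ℕ, b.ker.index = 2 ^ (2 * m) := by
  induction hn : b.ker.index using Nat.strong_induction_on generalizing G with
  | _ n ih =>
  subst hn
  have hsymm (x y : G) : b x y = b y x := by
    have h := halt (x + y)
    simp only [map_add, AddMonoidHom.add_apply, halt, zero_add, add_zero] at h
    rw [eq_neg_of_add_eq_zero_right h, ZModModule.neg_eq_self]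
  by_cases hb : b = 0
  · exact ⟨0, by simp [hb]⟩
  obtain ⟨x, y, hxy⟩ : ∃ x y, b x y ≠ 0 := by
    by_contra! h
    exact hb (by ext x y; exact h x y)
  replace hxy : b x y = 1 := Fin.eq_one_of_ne_zero _ hxy
  have hyx : b y x = 1 := hsymm y x ▸ hxy
  let T : G →+ ZMod 2 × ZMod 2 := (b x).prod (b y)
  have hT : Function.Surjective T := by
    rintro ⟨s, t⟩
    refine ⟨s.val • y + t.val • x, ?_⟩
    simp [T, halt, hxy, hyx]
  have hTindex : T.ker.index = 4 := by
    rw [AddSubgroup.index_ker, AddMonoidHom.range_eq_top.mpr hT]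
    simp
  let c : T.ker →+ T.ker →+ ZMod 2 := (b.compl₂ T.ker.subtype).comp T.ker.subtype
  have hle : b.ker ≤ T.ker := fun r hr ↦ by
    rw [AddMonoidHom.mem_ker] at hr ⊢
    simp [T, hsymm _ r, hr]
  have hc : c.ker = b.ker.addSubgroupOf T.ker := by
    ext ⟨w, hw⟩
    simp only [AddSubgroup.mem_addSubgroupOf, AddMonoidHom.mem_ker]
    constructor
    · intro h
      have hw' : b x w = 0 ∧ b y w = 0 := by simpa [T, AddMonoidHom.mem_ker] using hw
      ext v
      let u := v - ((b x v).val • y + (b y v).val • x)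
      have hu : u ∈ T.ker := by
        simp [T, u, AddMonoidHom.mem_ker, halt, hxy, hyx]
      have hwu : b w u = 0 := DFunLike.congr_fun h ⟨u, hu⟩
      simpa [u, hsymm w x, hsymm w y, hw'.1, hw'.2] using hwu
    · intro h
      ext v
      exact DFunLike.congr_fun h v.1
  have hindex : c.ker.index * 4 = b.ker.index := by
    rw [hc, ← hTindex]
    exact AddSubgroup.relIndex_mul_index hle
  obtain ⟨m, hm⟩ := ih c.ker.index (by lia) c (fun w ↦ halt w) (by lia) rfl
  exact ⟨m + 1, by rw [← hindex, hm]; ring⟩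

/-- The dual of a full-rank lattice is finitely generated, and its double dual is the lattice
itself. -/
theorem fg_dualSubmodule_innerₗ_and_dualSubmodule_dualSubmodule
    {E : Type*} [NormedAddCommGroup E] [InnerProductSpace ℝ E] [FiniteDimensional ℝ E]
    (L : Submodule ℤ E) [DiscreteTopology L] [IsZLattice ℝ L] :
    (LinearMap.BilinForm.dualSubmodule (innerₗ E) L).FG ∧
      LinearMap.BilinForm.dualSubmodule (innerₗ E)
        (LinearMap.BilinForm.dualSubmodule (innerₗ E) L) = L := by
  classical
  have : Module.Finite ℤ L := ZLattice.module_finite ℝ L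
  have : Module.Free ℤ L := ZLattice.module_free ℝ L
  let v := (Module.Free.chooseBasis ℤ L).ofZLatticeBasis ℝ L
  have hv : Submodule.span ℤ (Set.range v) = L := Module.Basis.ofZLatticeBasis_span ..
  have hB : LinearMap.BilinForm.Nondegenerate (innerₗ E) :=
    ⟨fun x hx ↦ inner_self_eq_zero.mp (hx x), fun x hx ↦ inner_self_eq_zero.mp (hx x)⟩
  constructor
  · rw [← hv, LinearMap.BilinForm.dualSubmodule_span_of_basis _ hB]
    exact Submodule.fg_span (Set.finite_range _)
  · have h := LinearMap.BilinForm.dualSubmodule_dualSubmodule_of_basis (R := ℤ) (innerₗ E) hB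
      ⟨fun x y ↦ real_inner_comm y x⟩ v
    rwa [hv] at h

/-- A 2-elementary totally even full-rank lattice `L` in a real inner product
space has discriminant group `L*/L` of order `2 ^ (2 * m)` for some natural number `m`. -/
theorem two_elementary_totally_even_lattice_card_discriminant_group
    {E : Type*} [NormedAddCommGroup E] [InnerProductSpace ℝ E] [FiniteDimensional ℝ E]
    (L Ldual : Submodule ℤ E) [DiscreteTopology ↥L]
    (hspan : Submodule.span ℝ (L : Set E) = ⊤)
    (hdual : ∀ x : E, x ∈ Ldual ↔ ∀ y ∈ L, ∃ n : ℤ, ⟪x, y⟫ = (n : ℝ))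
    (heven : ∀ x ∈ L, ∃ n : ℤ, ⟪x, x⟫ = (2 * n : ℤ))
    (h2elem : ∀ x ∈ Ldual, (2 : ℤ) • x ∈ L)
    (htotallyeven : ∀ x ∈ Ldual, ∃ n : ℤ, ⟪x, x⟫ = (n : ℝ)) :
    ∃ m : ℕ, Nat.card (↥Ldual ⧸ (L.comap Ldual.subtype)) = 2 ^ (2 * m) := by
  have : IsZLattice ℝ L := ⟨hspan⟩
  have hLdual : Ldual = LinearMap.BilinForm.dualSubmodule (innerₗ E) L := by
    ext x
    simp [hdual, LinearMap.BilinForm.mem_dualSubmodule, Submodule.mem_one, eq_comm]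
  obtain ⟨hfg, hdd⟩ := fg_dualSubmodule_innerₗ_and_dualSubmodule_dualSubmodule L
  rw [← hLdual] at hfg hdd
  have hL (x : E) : x ∈ L ↔ ∀ y ∈ Ldual, ∃ n : ℤ, ⟪x, y⟫ = (n : ℝ) := by
    conv_lhs => rw [← hdd]
    simp [LinearMap.BilinForm.mem_dualSubmodule, Submodule.mem_one, eq_comm]
  have hint (x y : Ldual) : ∃ n : ℤ, 2 * ⟪(x : E), y⟫ = (n : ℝ) := by
    obtain ⟨n, hn⟩ := (hdual x).mp x.2 _ (h2elem y y.2)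
    refine ⟨n, ?_⟩
    rw [← hn, ← Int.cast_smul_eq_zsmul ℝ, real_inner_smul_right]
    norm_num
  choose f hf using hint
  let b : Ldual →+ Ldual →+ ZMod 2 :=
    AddMonoidHom.mk' (fun x ↦ AddMonoidHom.mk' (fun y ↦ (f x y : ZMod 2)) fun y z ↦ by
      have h : f x (y + z) = f x y + f x z := by
        have : (f x (y + z) : ℝ) = f x y + f x z := by
          simp only [← hf, Submodule.coe_add, inner_add_right, mul_add]
        exact_mod_cast this
      simp [h]) fun x z ↦ by
      ext y
      have h : f (x + z) y = f x y + f z y := by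
        have : (f (x + z) y : ℝ) = f x y + f z y := by
          simp only [← hf, Submodule.coe_add, inner_add_left, mul_add]
        exact_mod_cast this
      simp [h]
  have hb (x y : Ldual) : b x y = 0 ↔ ∃ n : ℤ, ⟪(x : E), y⟫ = (n : ℝ) := by
    change (f x y : ZMod 2) = 0 ↔ _
    rw [ZMod.intCast_zmod_eq_zero_iff_dvd]
    refine exists_congr fun n ↦ ?_
    rw [← @Int.cast_inj ℝ, ← hf]
    push_cast
    exact mul_right_inj' two_ne_zero
  have hker : b.ker = (L.comap Ldual.subtype).toAddSubgroup := by
    ext x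
    simp [AddMonoidHom.mem_ker, DFunLike.ext_iff, hb, hL]
  have : Module.Finite ℤ Ldual := Module.Finite.iff_fg.mpr hfg
  have hfinite : Finite (Ldual ⧸ L.comap Ldual.subtype) := by
    refine Module.finite_of_fg_torsion _ fun {q} ↦ ?_
    obtain ⟨x, rfl⟩ := Submodule.Quotient.mk_surjective _ q
    refine ⟨⟨2, by simp⟩, ?_⟩
    exact (Submodule.Quotient.mk_eq_zero _).mpr (h2elem x x.2)
  have hcard : Nat.card (Ldual ⧸ L.comap Ldual.subtype) = b.ker.index := by
    rw [hker]
    rfl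
  rw [hcard]
  exact b.exists_index_ker_eq_two_pow_of_alternating
    (fun x ↦ (hb x x).mpr (htotallyeven x x.2)) (hcard ▸ Nat.card_pos.ne')
end
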